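/- arXiv:2604.01946 — 5 statements merged into one kernel-verified Lean document; each statement's English description precedes it below -/
import Mathlib

section
/- Under the identification and positivity assumption and the one-sided reward certificate assumption, every measurable individualized treatment rule d : 𝒳 → {−1,1} satisfies V*(d) ≥ V_R̲(d). If in addition U(X,A,R) ≤ R almost surely, then R̲ = R − U(X,A,R) almost surely and V*(d) ≥ V(d) − E[ U(X,A,R)·1{A = d(X)} / π(A|X) ]. -/
open MeasureTheory ProbabilityTheory Real

section InverseProbabilityWeighting

variable {Ω : Type*} {m mΩ : MeasurableSpace Ω} [StandardBorelSpace Ω] {μ : Measure Ω}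
  [IsFiniteMeasure μ] {hm : m ≤ mΩ}

/-- The conditional expectation of a product of conditionally independent real random variables
is the product of their conditional expectations. -/
theorem condExp_mul_of_condIndepFun {f g : Ω → ℝ} (h : CondIndepFun m hm f g μ)
    (hf : Measurable f) (hg : Measurable g) (hfi : Integrable f μ) (hgi : Integrable g μ)
    (hfgi : Integrable (fun ω => f ω * g ω) μ) :
    μ[fun ω => f ω * g ω | m] =ᵐ[μ] fun ω => (μ[f | m]) ω * (μ[g | m]) ω := by
  have hker := ae_of_ae_trim hm ((condIndepFun_iff_map_prod_eq_prod_map_map hf hg).1 h)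
  filter_upwards [hker, condExp_ae_eq_integral_condExpKernel hm hfi,
    condExp_ae_eq_integral_condExpKernel hm hgi,
    condExp_ae_eq_integral_condExpKernel hm hfgi] with ω hω h₁ h₂ h₃
  rw [h₁, h₂, h₃]
  refine IndepFun.integral_fun_mul_eq_mul_integral ?_ hf.aestronglyMeasurable
    hg.aestronglyMeasurable
  rw [indepFun_iff_map_prod_eq_prod_map_map hf.aemeasurable hg.aemeasurable]
  rwa [Kernel.map_apply _ (hf.prodMk hg), Kernel.prod_apply, Kernel.map_apply _ hf,
    Kernel.map_apply _ hg] at hω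

/-- In the integral of a product of conditionally independent `f` and `g` against a bounded
`m`-measurable weight, `g` may be replaced by its conditional expectation. -/
theorem integral_mul_mul_of_condIndepFun {f g w p : Ω → ℝ} (h : CondIndepFun m hm f g μ)
    (hf : Measurable f) (hg : Measurable g) (hw : StronglyMeasurable[m] w)
    (hp : StronglyMeasurable[m] p) (hgp : μ[g | m] =ᵐ[μ] p)
    (hfi : Integrable f μ) (hgi : Integrable g μ)
    (hfgi : Integrable (fun ω => f ω * g ω) μ)
    (hwfgi : Integrable (fun ω => w ω * (f ω * g ω)) μ)
    (hwpfi : Integrable (fun ω => w ω * p ω * f ω) μ) :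
    ∫ ω, w ω * (f ω * g ω) ∂μ = ∫ ω, w ω * p ω * f ω ∂μ := by
  rw [← integral_condExp hm (f := fun ω => w ω * (f ω * g ω)),
    ← integral_condExp hm (f := fun ω => w ω * p ω * f ω)]
  refine integral_congr_ae ?_
  filter_upwards [condExp_mul_of_stronglyMeasurable_left hw hwfgi hfgi,
    condExp_mul_of_stronglyMeasurable_left (hw.mul hp) hwpfi hfi,
    condExp_mul_of_condIndepFun h hf hg hfi hgi hfgi, hgp] with ω h₁ h₂ h₃ h₄
  refine h₁.trans (Eq.trans ?_ h₂.symm)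
  simp only [Pi.mul_apply, h₃, h₄]
  ring

end InverseProbabilityWeighting

/-- A family of measurable functions indexed by the integers stays measurable after substituting a
measurable index. -/
theorem measurable_apply_int_index {Ω α : Type*} [MeasurableSpace Ω] [MeasurableSpace α]
    {q : ℤ → α → ℝ} (hq : ∀ a, Measurable (q a)) {A : Ω → ℤ} (hA : Measurable A) {X : Ω → α}
    (hX : Measurable X) : Measurable fun ω => q (A ω) (X ω) :=
  (measurable_from_prod_countable_right (f := fun z : ℤ × α => q z.1 z.2) hq).comp
    (hA.prodMk hX)

/-- Inverse-propensity-weighted bounded variables are integrable under positivity. -/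
theorem integrable_ipw {Ω α : Type*} [MeasurableSpace Ω] [MeasurableSpace α] {P : Measure Ω}
    [IsFiniteMeasure P] {X : Ω → α} (hX : Measurable X) {A : Ω → ℤ} (hA : Measurable A)
    (hA1 : ∀ ω, A ω = 1 ∨ A ω = -1) {pr : ℤ → α → ℝ} (hpr : ∀ a, Measurable (pr a))
    {ε : ℝ} (hε : 0 < ε) (hprε : ∀ a ∈ ({1, -1} : Set ℤ), ∀ x, ε ≤ pr a x)
    {d : α → ℤ} (hd : Measurable d) {F : Ω → ℝ} (hF : Measurable F)
    (hF01 : ∀ ω, F ω ∈ Set.Icc (0 : ℝ) 1) :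
    Integrable (fun ω => F ω * (if A ω = d (X ω) then (1 : ℝ) else 0) / pr (A ω) (X ω)) P := by
  have hset : MeasurableSet {ω | A ω = d (X ω)} := measurableSet_eq_fun hA (hd.comp hX)
  have hmeas : Measurable
      (fun ω => F ω * (if A ω = d (X ω) then (1 : ℝ) else 0) / pr (A ω) (X ω)) :=
    (hF.mul (Measurable.ite hset measurable_const measurable_const)).div
      (measurable_apply_int_index hpr hA hX)
  refine Integrable.of_bound hmeas.aestronglyMeasurable (1 / ε) (ae_of_all _ fun ω => ?_)
  have hp : ε ≤ pr (A ω) (X ω) := hprε _ (hA1 ω) _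
  obtain ⟨h0, h1⟩ := hF01 ω
  rw [Real.norm_eq_abs, abs_div, abs_of_pos (hε.trans_le hp)]
  refine div_le_div₀ zero_le_one ?_ hε hp
  split_ifs <;> simp [abs_of_nonneg h0, h1]

/-- **Inverse propensity weighting.** If each potential outcome is conditionally independent of the
treatment given the covariates, the value of a rule `d` equals its inverse-propensity-weighted
value. -/
theorem integral_ipw_eq {Ω α : Type*} [MeasurableSpace Ω] [StandardBorelSpace Ω]
    [MeasurableSpace α] {P : Measure Ω} [IsFiniteMeasure P] {X : Ω → α} (hX : Measurable X)
    {A : Ω → ℤ} (hA : Measurable A) (hA1 : ∀ ω, A ω = 1 ∨ A ω = -1)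
    {Y : ℤ → Ω → ℝ} (hY : ∀ a, Measurable (Y a)) (hY01 : ∀ a ω, Y a ω ∈ Set.Icc (0 : ℝ) 1)
    (hindep : ∀ a ∈ ({1, -1} : Set ℤ),
      CondIndepFun (MeasurableSpace.comap X inferInstance) hX.comap_le (Y a) A P)
    {pr : ℤ → α → ℝ} (hpr : ∀ a, Measurable (pr a))
    (hprver : ∀ a ∈ ({1, -1} : Set ℤ),
      (P[(fun ω => if A ω = a then (1 : ℝ) else 0) |
          MeasurableSpace.comap X inferInstance]) =ᵐ[P] fun ω => pr a (X ω))
    {ε : ℝ} (hε : 0 < ε) (hprε : ∀ a ∈ ({1, -1} : Set ℤ), ∀ x, ε ≤ pr a x)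
    {d : α → ℤ} (hd : Measurable d) (hd1 : ∀ x, d x = 1 ∨ d x = -1) :
    ∫ ω, Y (A ω) ω * (if A ω = d (X ω) then (1 : ℝ) else 0) / pr (A ω) (X ω) ∂P
      = ∫ ω, Y (d (X ω)) ω ∂P := by
  have hind : ∀ a, Measurable fun b : ℤ => if b = a then (1 : ℝ) else 0 :=
    fun a => measurable_from_top
  let w : ℤ → α → ℝ := fun a x => (if d x = a then (1 : ℝ) else 0) / pr a x
  have hw : ∀ a, Measurable (w a) := fun a => ((hind a).comp hd).div (hpr a)
  have hX' : Measurable[MeasurableSpace.comap X inferInstance] X := comap_measurable X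
  have hYi : ∀ a, Integrable (Y a) P := fun a =>
    Integrable.of_bound (hY a).aestronglyMeasurable 1 (ae_of_all _ fun ω => by
      rw [Real.norm_eq_abs, abs_of_nonneg (hY01 a ω).1]; exact (hY01 a ω).2)
  have hwbound : ∀ a ∈ ({1, -1} : Set ℤ), ∀ᵐ ω ∂P, ‖w a (X ω)‖ ≤ 1 / ε := fun a ha =>
    ae_of_all _ fun ω => by
      have hp := hprε a ha (X ω)
      simp only [w]
      rw [Real.norm_eq_abs, abs_div, abs_of_pos (hε.trans_le hp)]
      refine div_le_div₀ zero_le_one ?_ hε hp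
      split_ifs <;> simp
  have hYA : ∀ a, Integrable (fun ω => Y a ω * if A ω = a then (1 : ℝ) else 0) P := fun a =>
    (hYi a).mul_bdd (c := 1) ((hind a).comp hA).aestronglyMeasurable (ae_of_all _ fun ω => by
      split_ifs <;> simp)
  have hwYA : ∀ a ∈ ({1, -1} : Set ℤ),
      Integrable (fun ω => w a (X ω) * (Y a ω * if A ω = a then (1 : ℝ) else 0)) P :=
    fun a ha => (hYA a).bdd_mul ((hw a).comp hX).aestronglyMeasurable (hwbound a ha)
  have hwp : ∀ a ∈ ({1, -1} : Set ℤ), ∀ ω,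
      w a (X ω) * pr a (X ω) * Y a ω = (if d (X ω) = a then (1 : ℝ) else 0) * Y a ω :=
    fun a ha ω => by
      simp only [w]
      rw [div_mul_cancel₀ _ (hε.trans_le (hprε a ha (X ω))).ne']
  have hdY : ∀ a, Integrable (fun ω => (if d (X ω) = a then (1 : ℝ) else 0) * Y a ω) P :=
    fun a => (hYi a).bdd_mul (c := 1) ((hind a).comp (hd.comp hX)).aestronglyMeasurable
      (ae_of_all _ fun ω => by split_ifs <;> simp)
  have key : ∀ a ∈ ({1, -1} : Set ℤ),
      ∫ ω, w a (X ω) * (Y a ω * if A ω = a then (1 : ℝ) else 0) ∂P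
        = ∫ ω, (if d (X ω) = a then (1 : ℝ) else 0) * Y a ω ∂P := fun a ha => by
    have hIi : Integrable (fun ω => if A ω = a then (1 : ℝ) else 0) P :=
      Integrable.of_bound ((hind a).comp hA).aestronglyMeasurable 1 (ae_of_all _ fun ω => by
        split_ifs <;> simp)
    refine (integral_mul_mul_of_condIndepFun ((hindep a ha).comp measurable_id (hind a)) (hY a)
      ((hind a).comp hA) ((hw a).comp hX').stronglyMeasurable
      ((hpr a).comp hX').stronglyMeasurable (hprver a ha) (hYi a) hIi (hYA a) (hwYA a ha)
      ((hdY a).congr (ae_of_all _ fun ω => (hwp a ha ω).symm))).trans ?_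
    exact integral_congr_ae (ae_of_all _ (hwp a ha))
  have h1 : (1 : ℤ) ∈ ({1, -1} : Set ℤ) := by simp
  have h2 : (-1 : ℤ) ∈ ({1, -1} : Set ℤ) := by simp
  calc _ = ∫ ω, (w 1 (X ω) * (Y 1 ω * if A ω = 1 then (1 : ℝ) else 0)
          + w (-1) (X ω) * (Y (-1) ω * if A ω = -1 then (1 : ℝ) else 0)) ∂P := by
        refine integral_congr_ae (ae_of_all _ fun ω => ?_)
        rcases hA1 ω with h | h <;> rcases hd1 (X ω) with h' | h' <;>
          simp [w, h, h', div_eq_mul_inv, mul_comm]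
    _ = ∫ ω, ((if d (X ω) = 1 then (1 : ℝ) else 0) * Y 1 ω
          + (if d (X ω) = -1 then (1 : ℝ) else 0) * Y (-1) ω) ∂P := by
        rw [integral_add (hwYA 1 h1) (hwYA (-1) h2), integral_add (hdY 1) (hdY (-1)),
          key 1 h1, key (-1) h2]
    _ = _ := by
        refine integral_congr_ae (ae_of_all _ fun ω => ?_)
        rcases hd1 (X ω) with h' | h' <;> simp [h']

/-- **Certified lower-value domination.**
Under identification/positivity and the one-sided reward certificate, every measurable ITR `d`
satisfies `V*(d) ≥ V_R̲(d)`; if moreover `U(X,A,R) ≤ R` a.s. then `R̲ = R − U(X,A,R)` a.s. and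
`V*(d) ≥ V(d) − E[ U(X,A,R)·1{A = d(X)} / π(A|X) ]`. -/
theorem certified_lower_value_domination
    {Ω 𝒳 : Type*} [MeasurableSpace Ω] [StandardBorelSpace Ω] [MeasurableSpace 𝒳]
    (P : Measure Ω) [IsProbabilityMeasure P]
    (X : Ω → 𝒳) (hX : Measurable X)
    (A : Ω → ℤ) (hA : Measurable A) (hA1 : ∀ ω, A ω = 1 ∨ A ω = -1)
    (R Rstar : Ω → ℝ) (hR : Measurable R) (hRstar : Measurable Rstar)
    (hR01 : ∀ ω, R ω ∈ Set.Icc (0 : ℝ) 1) (hRstar01 : ∀ ω, Rstar ω ∈ Set.Icc (0 : ℝ) 1)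
    (Rpot Rstarpot : ℤ → Ω → ℝ)
    (hRpot : ∀ a, Measurable (Rpot a)) (hRstarpot : ∀ a, Measurable (Rstarpot a))
    (hRpot01 : ∀ a ω, Rpot a ω ∈ Set.Icc (0 : ℝ) 1)
    (hRstarpot01 : ∀ a ω, Rstarpot a ω ∈ Set.Icc (0 : ℝ) 1)
    (hcons : ∀ a ∈ ({1, -1} : Set ℤ),
      ∀ᵐ ω ∂P, A ω = a → R ω = Rpot a ω ∧ Rstar ω = Rstarpot a ω)
    (hignor : CondIndepFun (MeasurableSpace.comap X inferInstance) hX.comap_le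
      (fun ω => (Rpot 1 ω, Rpot (-1) ω, Rstarpot 1 ω, Rstarpot (-1) ω)) A P)
    (pr : ℤ → 𝒳 → ℝ) (hpr : ∀ a, Measurable (pr a))
    (hprver : ∀ a ∈ ({1, -1} : Set ℤ),
      (P[(fun ω => if A ω = a then (1 : ℝ) else 0) |
          MeasurableSpace.comap X inferInstance]) =ᵐ[P] fun ω => pr a (X ω))
    (ε : ℝ) (hε : ε ∈ Set.Ioc (0 : ℝ) (1 / 2))
    (hprε : ∀ a ∈ ({1, -1} : Set ℤ), ∀ x, ε ≤ pr a x)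
    -- the one-sided reward certificate
    (U : 𝒳 → ℤ → ℝ → ℝ)
    (hU : Measurable fun q : 𝒳 × ℤ × ℝ => U q.1 q.2.1 q.2.2)
    (hU01 : ∀ x a r, U x a r ∈ Set.Icc (0 : ℝ) 1)
    (hcert : ∀ᵐ ω ∂P, R ω - U (X ω) (A ω) (R ω) ≤ Rstar ω)
    -- a measurable individualized treatment rule
    (d : 𝒳 → ℤ) (hd : Measurable d) (hd1 : ∀ x, d x = 1 ∨ d x = -1) :
    -- `V*(d) ≥ V_R̲(d)` where `R̲ = (R − U(X,A,R))₊`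
    (∫ ω, max (R ω - U (X ω) (A ω) (R ω)) 0
          * (if A ω = d (X ω) then (1 : ℝ) else 0) / pr (A ω) (X ω) ∂P)
      ≤ ∫ ω, Rstarpot (d (X ω)) ω ∂P ∧
    -- if in addition `U ≤ R` a.s., then `R̲ = R − U` a.s. and the unclipped bound holds
    ((∀ᵐ ω ∂P, U (X ω) (A ω) (R ω) ≤ R ω) →
      (∀ᵐ ω ∂P,
          max (R ω - U (X ω) (A ω) (R ω)) 0 = R ω - U (X ω) (A ω) (R ω)) ∧
      (∫ ω, Rpot (d (X ω)) ω ∂P)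
          - (∫ ω, U (X ω) (A ω) (R ω)
              * (if A ω = d (X ω) then (1 : ℝ) else 0) / pr (A ω) (X ω) ∂P)
        ≤ ∫ ω, Rstarpot (d (X ω)) ω ∂P) := by
  have hε0 : 0 < ε := hε.1
  have hUm : Measurable fun ω => U (X ω) (A ω) (R ω) := hU.comp (hX.prodMk (hA.prodMk hR))
  have hcons' : ∀ᵐ ω ∂P, R ω = Rpot (A ω) ω ∧ Rstar ω = Rstarpot (A ω) ω := by
    filter_upwards [hcons 1 (by simp), hcons (-1) (by simp)] with ω h₁ h₂
    rcases hA1 ω with h | h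
    · simpa only [h] using h₁ h
    · simpa only [h] using h₂ h
  have hw : ∀ ω, 0 ≤ (if A ω = d (X ω) then (1 : ℝ) else 0) / pr (A ω) (X ω) := fun ω =>
    div_nonneg (by split_ifs <;> simp) (hε0.le.trans (hprε _ (hA1 ω) _))
  have hint : ∀ {F : Ω → ℝ}, Measurable F → (∀ ω, F ω ∈ Set.Icc (0 : ℝ) 1) →
      Integrable (fun ω => F ω * (if A ω = d (X ω) then (1 : ℝ) else 0) / pr (A ω) (X ω)) P :=
    fun hF hF01 => integrable_ipw hX hA hA1 hpr hε0 hprε hd hF hF01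
  have hRi := hint hR hR01
  have hRstari := hint hRstar hRstar01
  have hUi := hint hUm fun ω => hU01 _ _ _
  have hLi := hint (F := fun ω => max (R ω - U (X ω) (A ω) (R ω)) 0)
    ((hR.sub hUm).max measurable_const) fun ω =>
      ⟨le_max_right _ _, max_le (by linarith [(hR01 ω).2, (hU01 (X ω) (A ω) (R ω)).1])
        zero_le_one⟩
  have hVstar : ∫ ω, Rstar ω * (if A ω = d (X ω) then (1 : ℝ) else 0) / pr (A ω) (X ω) ∂P
      = ∫ ω, Rstarpot (d (X ω)) ω ∂P := by
    rw [← integral_ipw_eq hX hA hA1 hRstarpot hRstarpot01 ?_ hpr hprver hε0 hprε hd hd1]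
    · refine integral_congr_ae ?_
      filter_upwards [hcons'] with ω h
      rw [h.2]
    · rintro a (rfl | rfl)
      · exact hignor.comp (φ := fun z : ℝ × ℝ × ℝ × ℝ => z.2.2.1) (by fun_prop) measurable_id
      · exact hignor.comp (φ := fun z : ℝ × ℝ × ℝ × ℝ => z.2.2.2) (by fun_prop) measurable_id
  have hV : ∫ ω, R ω * (if A ω = d (X ω) then (1 : ℝ) else 0) / pr (A ω) (X ω) ∂P
      = ∫ ω, Rpot (d (X ω)) ω ∂P := by
    rw [← integral_ipw_eq hX hA hA1 hRpot hRpot01 ?_ hpr hprver hε0 hprε hd hd1]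
    · refine integral_congr_ae ?_
      filter_upwards [hcons'] with ω h
      rw [h.1]
    · rintro a (rfl | rfl)
      · exact hignor.comp (φ := fun z : ℝ × ℝ × ℝ × ℝ => z.1) (by fun_prop) measurable_id
      · exact hignor.comp (φ := fun z : ℝ × ℝ × ℝ × ℝ => z.2.1) (by fun_prop) measurable_id
  refine ⟨?_, fun hUR => ⟨?_, ?_⟩⟩
  · rw [← hVstar]
    refine integral_mono_ae hLi hRstari ?_
    filter_upwards [hcert] with ω h
    simp only [mul_div_assoc]
    exact mul_le_mul_of_nonneg_right (max_le h (hRstar01 ω).1) (hw ω)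
  · filter_upwards [hUR] with ω h
    exact max_eq_left (sub_nonneg.2 h)
  · rw [← hVstar, ← hV, ← integral_sub hRi hUi]
    refine integral_mono_ae (hRi.sub hUi) hRstari ?_
    filter_upwards [hcert] with ω h
    simp only [mul_div_assoc, ← sub_mul]
    exact mul_le_mul_of_nonneg_right h (hw ω)
end

section
/- Under the identification and positivity assumption and the one-sided reward certificate assumption, for every measurable individualized treatment rule d : 𝒳 → {−1,1} and every α ∈ 𝒜, V_R̲(d) = E[Γ_d^α(Z)] = C_α^♯ − R01^α(d). Consequently, for each fixed α, maximizing V_R̲(d) over measurable d is equivalent to minimizing the weighted 0–1 risk R01^α(d). Moreover, a measurable rule d is Bayes-optimal for V_R̲ if and only if d(x) ∈ argmax_{a ∈ {−1,1}} μ_a(x) for P_X-almost every x; in particular d*_R̲(x) := sgn(μ_1(x) − μ_{−1}(x)) (with sgn(0)=1) is Bayes-optimal. -/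
open MeasureTheory ProbabilityTheory Real

/-- measurable individualized treatment rule with values in `{−1,1}` -/
def IsRule {𝒳 : Type*} [MeasurableSpace 𝒳] (d : 𝒳 → ℤ) : Prop :=
  Measurable d ∧ ∀ x, d x = 1 ∨ d x = -1

/-- the certified lower reward `R̲ = (R − U(X,A,R))₊` -/
noncomputable def Rlow {Ω 𝒳 : Type*} (X : Ω → 𝒳) (A : Ω → ℤ) (R : Ω → ℝ)
    (U : 𝒳 → ℤ → ℝ → ℝ) (ω : Ω) : ℝ :=
  max (R ω - U (X ω) (A ω) (R ω)) 0

/-- the doubly robust score `Γ_a^α(Z)` -/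
noncomputable def Gam {Ω 𝒳 𝒜 : Type*} (X : Ω → 𝒳) (A : Ω → ℤ) (pr : ℤ → 𝒳 → ℝ)
    (ν : ℤ → 𝒳 → 𝒜 → ℝ) (Rl : Ω → ℝ) (a : ℤ) (α : 𝒜) (ω : Ω) : ℝ :=
  ν a (X ω) α + (if A ω = a then (1 : ℝ) else 0) / pr a (X ω) * (Rl ω - ν a (X ω) α)

/-- the certified value `V_R̲(d)` -/
noncomputable def VR {Ω 𝒳 : Type*} [MeasurableSpace Ω] (P : Measure Ω)
    (X : Ω → 𝒳) (A : Ω → ℤ) (pr : ℤ → 𝒳 → ℝ) (Rl : Ω → ℝ) (d : 𝒳 → ℤ) : ℝ :=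
  ∫ ω, Rl ω * (if A ω = d (X ω) then (1 : ℝ) else 0) / pr (A ω) (X ω) ∂P

lemma Rlow_mem_Icc {Ω 𝒳 : Type*} {X : Ω → 𝒳} {A : Ω → ℤ} {R : Ω → ℝ}
    {U : 𝒳 → ℤ → ℝ → ℝ} (hR01 : ∀ ω, R ω ∈ Set.Icc (0 : ℝ) 1)
    (hU01 : ∀ x a r, U x a r ∈ Set.Icc (0 : ℝ) 1) (ω : Ω) :
    Rlow X A R U ω ∈ Set.Icc (0 : ℝ) 1 :=
  ⟨le_max_right _ _, max_le (by linarith [(hR01 ω).2, (hU01 (X ω) (A ω) (R ω)).1]) zero_le_one⟩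

section Helpers

variable {Ω 𝒳 𝒜 : Type*} [MeasurableSpace Ω] [MeasurableSpace 𝒳] [MeasurableSpace 𝒜]
  {P : Measure Ω} [IsProbabilityMeasure P] {X : Ω → 𝒳} {A : Ω → ℤ} {R : Ω → ℝ}
  {pr : ℤ → 𝒳 → ℝ} {U : 𝒳 → ℤ → ℝ → ℝ} {ν : ℤ → 𝒳 → 𝒜 → ℝ} {ε : ℝ}

/-- A bounded function of `X` may be integrated against a version of `E[f | X]` in place of `f`. -/
lemma integral_comp_mul_eq_of_condExp_ae_eq (hX : Measurable X) {f : Ω → ℝ} (hf : Integrable f P)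
    {h : 𝒳 → ℝ}
    (hfh : P[f | MeasurableSpace.comap X inferInstance] =ᵐ[P] fun ω => h (X ω))
    {g : 𝒳 → ℝ} (hg : Measurable g) {C : ℝ} (hgC : ∀ x, |g x| ≤ C) :
    ∫ ω, g (X ω) * f ω ∂P = ∫ ω, g (X ω) * h (X ω) ∂P := by
  have hgm : StronglyMeasurable[MeasurableSpace.comap X inferInstance] (fun ω => g (X ω)) :=
    (hg.comp (comap_measurable X)).stronglyMeasurable
  have hint : Integrable ((fun ω => g (X ω)) * f) P :=
    hf.bdd_mul (hg.comp hX).aestronglyMeasurable (Filter.Eventually.of_forall fun ω => hgC (X ω))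
  have hpull := condExp_mul_of_stronglyMeasurable_left hgm hint hf
  calc ∫ ω, g (X ω) * f ω ∂P
      = ∫ ω, (P[(fun ω => g (X ω)) * f | MeasurableSpace.comap X inferInstance]) ω ∂P :=
        (integral_condExp hX.comap_le).symm
    _ = ∫ ω, g (X ω) * h (X ω) ∂P := by
        refine integral_congr_ae ?_
        filter_upwards [hpull, hfh] with ω h1 h2
        rw [h1, Pi.mul_apply, h2]

lemma measurable_Rlow (hX : Measurable X) (hA : Measurable A) (hR : Measurable R)
    (hU : Measurable fun q : 𝒳 × ℤ × ℝ => U q.1 q.2.1 q.2.2) :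
    Measurable (Rlow X A R U) :=
  (hR.sub (hU.comp (hX.prodMk (hA.prodMk hR)))).max measurable_const

lemma measurable_indicator_eq (hA : Measurable A) (a : ℤ) :
    Measurable fun ω => if A ω = a then (1 : ℝ) else 0 :=
  Measurable.ite (hA (measurableSet_singleton a)) measurable_const measurable_const

lemma integrable_Gam (hX : Measurable X) (hA : Measurable A) {Rl : Ω → ℝ} (hRl : Measurable Rl)
    (hRl01 : ∀ ω, Rl ω ∈ Set.Icc (0 : ℝ) 1) {a : ℤ} (hpr : Measurable (pr a))
    (hε : 0 < ε) (hprε : ∀ x, ε ≤ pr a x)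
    (hν : Measurable fun q : 𝒳 × 𝒜 => ν a q.1 q.2)
    (hν01 : ∀ x α, ν a x α ∈ Set.Icc (0 : ℝ) 1) (α : 𝒜) :
    Integrable (Gam X A pr ν Rl a α) P := by
  have hνX : Measurable fun ω => ν a (X ω) α := hν.comp (hX.prodMk measurable_const)
  refine Integrable.of_bound (C := 1 + 1 / ε * 1) (Measurable.aestronglyMeasurable ?_)
    (Filter.Eventually.of_forall fun ω => ?_)
  · exact hνX.add (((measurable_indicator_eq hA a).div (hpr.comp hX)).mul (hRl.sub hνX))
  · obtain ⟨h0, h1⟩ := hν01 (X ω) α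
    obtain ⟨r0, r1⟩ := hRl01 ω
    have hp := hprε (X ω)
    refine (norm_add_le _ _).trans (add_le_add ?_ ?_)
    · rw [Real.norm_eq_abs, abs_le]
      constructor <;> linarith
    · rw [norm_mul, norm_div, Real.norm_eq_abs, Real.norm_eq_abs, Real.norm_eq_abs,
        abs_of_pos (hε.trans_le hp)]
      have hi : |if A ω = a then (1 : ℝ) else 0| ≤ 1 := by split_ifs <;> simp
      have hd : |Rl ω - ν a (X ω) α| ≤ 1 := by rw [abs_le]; constructor <;> linarith
      gcongr

end Helpers

/-- **Exact certified reduction.** -/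
theorem exact_certified_reduction
    {Ω 𝒳 𝒜 : Type*} [MeasurableSpace Ω] [MeasurableSpace 𝒳] [MeasurableSpace 𝒜]
    (P : Measure Ω) [IsProbabilityMeasure P]
    (X : Ω → 𝒳) (hX : Measurable X)
    (A : Ω → ℤ) (hA : Measurable A) (hA1 : ∀ ω, A ω = 1 ∨ A ω = -1)
    (R : Ω → ℝ) (hR : Measurable R) (hR01 : ∀ ω, R ω ∈ Set.Icc (0 : ℝ) 1)
    -- propensity with positivity
    (pr : ℤ → 𝒳 → ℝ) (hpr : ∀ a, Measurable (pr a))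
    (hprver : ∀ a ∈ ({1, -1} : Set ℤ),
      (P[(fun ω => if A ω = a then (1 : ℝ) else 0) |
          MeasurableSpace.comap X inferInstance]) =ᵐ[P] fun ω => pr a (X ω))
    (ε : ℝ) (hε : ε ∈ Set.Ioc (0 : ℝ) (1 / 2))
    (hprε : ∀ a ∈ ({1, -1} : Set ℤ), ∀ x, ε ≤ pr a x)
    -- one-sided reward certificate, certified lower reward
    (U : 𝒳 → ℤ → ℝ → ℝ)
    (hU : Measurable fun q : 𝒳 × ℤ × ℝ => U q.1 q.2.1 q.2.2)
    (hU01 : ∀ x a r, U x a r ∈ Set.Icc (0 : ℝ) 1)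
    -- jointly measurable nuisances with values in `[0,1]`
    (ν : ℤ → 𝒳 → 𝒜 → ℝ)
    (hν : ∀ a, Measurable fun q : 𝒳 × 𝒜 => ν a q.1 q.2)
    (hν01 : ∀ a x α, ν a x α ∈ Set.Icc (0 : ℝ) 1)
    -- `μ_a(x) = E[R̲ | X = x, A = a]`, characterized by
    -- `E[R̲·1{A=a} | X] = μ_a(X)·π(a|X)` a.e.
    (μ : ℤ → 𝒳 → ℝ) (hμmeas : ∀ a, Measurable (μ a))
    (hμ : ∀ a ∈ ({1, -1} : Set ℤ),
      (P[(fun ω => Rlow X A R U ω * (if A ω = a then (1 : ℝ) else 0)) |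
          MeasurableSpace.comap X inferInstance])
        =ᵐ[P] fun ω => μ a (X ω) * pr a (X ω)) :
    -- (1) exact certified value representation: `V_R̲(d) = E[Γ_d^α(Z)]`
    (∀ d : 𝒳 → ℤ, IsRule d → ∀ α : 𝒜,
      VR P X A pr (Rlow X A R U) d
        = ∫ ω, Gam X A pr ν (Rlow X A R U) (d (X ω)) α ω ∂P) ∧
    -- (2) exact weighted classification reduction: `V_R̲(d) = C_α^♯ − R01^α(d)`
    (∀ d : 𝒳 → ℤ, IsRule d → ∀ α : 𝒜,
      VR P X A pr (Rlow X A R U) d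
        = (1 / 2) * (∫ ω, (Gam X A pr ν (Rlow X A R U) 1 α ω
              + Gam X A pr ν (Rlow X A R U) (-1) α ω
              + |Gam X A pr ν (Rlow X A R U) 1 α ω
                  - Gam X A pr ν (Rlow X A R U) (-1) α ω|) ∂P)
          - ∫ ω, |Gam X A pr ν (Rlow X A R U) 1 α ω
                  - Gam X A pr ν (Rlow X A R U) (-1) α ω|
              * (if (if 0 ≤ Gam X A pr ν (Rlow X A R U) 1 α ω
                        - Gam X A pr ν (Rlow X A R U) (-1) α ω then (1 : ℤ) else -1)
                    ≠ d (X ω) then (1 : ℝ) else 0) ∂P) ∧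
    -- (3) for fixed `α`, maximizing `V_R̲` is equivalent to minimizing the weighted 0–1 risk
    (∀ α : 𝒜, ∀ d : 𝒳 → ℤ, IsRule d →
      ((∀ d' : 𝒳 → ℤ, IsRule d' →
          VR P X A pr (Rlow X A R U) d' ≤ VR P X A pr (Rlow X A R U) d)
        ↔ (∀ d' : 𝒳 → ℤ, IsRule d' →
          (∫ ω, |Gam X A pr ν (Rlow X A R U) 1 α ω
                  - Gam X A pr ν (Rlow X A R U) (-1) α ω|
              * (if (if 0 ≤ Gam X A pr ν (Rlow X A R U) 1 α ω
                        - Gam X A pr ν (Rlow X A R U) (-1) α ω then (1 : ℤ) else -1)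
                    ≠ d (X ω) then (1 : ℝ) else 0) ∂P)
          ≤ ∫ ω, |Gam X A pr ν (Rlow X A R U) 1 α ω
                  - Gam X A pr ν (Rlow X A R U) (-1) α ω|
              * (if (if 0 ≤ Gam X A pr ν (Rlow X A R U) 1 α ω
                        - Gam X A pr ν (Rlow X A R U) (-1) α ω then (1 : ℤ) else -1)
                    ≠ d' (X ω) then (1 : ℝ) else 0) ∂P))) ∧
    -- (4) Bayes rules are exactly the a.e. pointwise argmax rules
    (∀ d : 𝒳 → ℤ, IsRule d →
      ((∀ d' : 𝒳 → ℤ, IsRule d' →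
          VR P X A pr (Rlow X A R U) d' ≤ VR P X A pr (Rlow X A R U) d)
        ↔ (∀ᵐ x ∂(P.map X), ∀ a ∈ ({1, -1} : Set ℤ), μ a x ≤ μ (d x) x))) ∧
    -- (5) `d*_R̲ = sgn(μ₁ − μ₋₁)` (with `sgn 0 = 1`) is Bayes-optimal
    (∀ d' : 𝒳 → ℤ, IsRule d' →
      VR P X A pr (Rlow X A R U) d'
        ≤ VR P X A pr (Rlow X A R U) (fun x => if 0 ≤ μ 1 x - μ (-1) x then 1 else -1)) := by
  have hε0 : 0 < ε := hε.1
  have m1 : (1 : ℤ) ∈ ({1, -1} : Set ℤ) := by simp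
  have m2 : (-1 : ℤ) ∈ ({1, -1} : Set ℤ) := by simp
  have hRl : Measurable (Rlow X A R U) := measurable_Rlow hX hA hR hU
  have hRl01 : ∀ ω, Rlow X A R U ω ∈ Set.Icc (0 : ℝ) 1 := Rlow_mem_Icc hR01 hU01
  set Rl := Rlow X A R U
  have hIint : ∀ a, Integrable (fun ω => if A ω = a then (1 : ℝ) else 0) P := fun a =>
    Integrable.of_bound (C := 1) (measurable_indicator_eq hA a).aestronglyMeasurable
      (Filter.Eventually.of_forall fun ω => by split_ifs <;> simp)
  have hTint : ∀ a, Integrable (fun ω => Rl ω * (if A ω = a then (1 : ℝ) else 0)) P := fun a =>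
    (hIint a).bdd_mul hRl.aestronglyMeasurable (c := 1)
      (Filter.Eventually.of_forall fun ω => by
        rw [Real.norm_eq_abs, abs_of_nonneg (hRl01 ω).1]; exact (hRl01 ω).2)
  have hμint : ∀ a ∈ ({1, -1} : Set ℤ), Integrable (fun ω => μ a (X ω)) P := by
    intro a ha
    have h1 : Integrable (fun ω => μ a (X ω) * pr a (X ω)) P :=
      integrable_condExp.congr (hμ a ha)
    refine (h1.bdd_mul (f := fun ω => (pr a (X ω))⁻¹) (c := ε⁻¹)
      ((hpr a).comp hX).inv.aestronglyMeasurable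
      (Filter.Eventually.of_forall fun ω => ?_)).congr (Filter.Eventually.of_forall fun ω => ?_)
    · have := hprε a ha (X ω)
      rw [norm_inv, Real.norm_eq_abs, abs_of_pos (hε0.trans_le this)]
      gcongr
    · have : pr a (X ω) ≠ 0 := (hε0.trans_le (hprε a ha (X ω))).ne'
      simp only
      field_simp
  have hΓint : ∀ a ∈ ({1, -1} : Set ℤ), ∀ α, Integrable (Gam X A pr ν Rl a α) P :=
    fun a ha α => integrable_Gam hX hA hRl hRl01 (hpr a) hε0 (hprε a ha) (hν a) (hν01 a) α
  -- weights `v(X)/π(a|X)` integrate the two conditional expectations exactly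
  have hwbd : ∀ a ∈ ({1, -1} : Set ℤ), ∀ v : 𝒳 → ℝ, (∀ x, v x ∈ Set.Icc (0 : ℝ) 1) →
      ∀ x, |v x / pr a x| ≤ 1 / ε := by
    intro a ha v hv x
    have := hprε a ha x
    rw [abs_div, abs_of_pos (hε0.trans_le this), abs_of_nonneg (hv x).1]
    have := (hv x).2
    gcongr
  have hwint : ∀ a ∈ ({1, -1} : Set ℤ), ∀ v : 𝒳 → ℝ, Measurable v →
      (∀ x, v x ∈ Set.Icc (0 : ℝ) 1) → ∀ f : Ω → ℝ, Integrable f P →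
      Integrable (fun ω => v (X ω) / pr a (X ω) * f ω) P := fun a ha v hvm hv f hf =>
    hf.bdd_mul ((hvm.div (hpr a)).comp hX).aestronglyMeasurable
      (Filter.Eventually.of_forall fun ω => hwbd a ha v hv (X ω))
  have hreward : ∀ a ∈ ({1, -1} : Set ℤ), ∀ v : 𝒳 → ℝ, Measurable v →
      (∀ x, v x ∈ Set.Icc (0 : ℝ) 1) →
      ∫ ω, v (X ω) / pr a (X ω) * (Rl ω * (if A ω = a then (1 : ℝ) else 0)) ∂P
        = ∫ ω, v (X ω) * μ a (X ω) ∂P := by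
    intro a ha v hvm hv
    rw [integral_comp_mul_eq_of_condExp_ae_eq (h := fun x => μ a x * pr a x)
      (g := fun x => v x / pr a x) hX (hTint a) (hμ a ha) (hvm.div (hpr a)) (hwbd a ha v hv)]
    congr 1 with ω
    have : pr a (X ω) ≠ 0 := (hε0.trans_le (hprε a ha (X ω))).ne'
    field_simp
  have hweight : ∀ a ∈ ({1, -1} : Set ℤ), ∀ v : 𝒳 → ℝ, Measurable v →
      (∀ x, v x ∈ Set.Icc (0 : ℝ) 1) →
      ∫ ω, v (X ω) / pr a (X ω) * (if A ω = a then (1 : ℝ) else 0) ∂P = ∫ ω, v (X ω) ∂P := by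
    intro a ha v hvm hv
    rw [integral_comp_mul_eq_of_condExp_ae_eq (h := fun x => pr a x)
      (g := fun x => v x / pr a x) hX (hIint a) (hprver a ha) (hvm.div (hpr a)) (hwbd a ha v hv)]
    congr 1 with ω
    have : pr a (X ω) ≠ 0 := (hε0.trans_le (hprε a ha (X ω))).ne'
    field_simp
  have hind01 : ∀ (d : 𝒳 → ℤ) a x, (if d x = a then (1 : ℝ) else 0) ∈ Set.Icc (0 : ℝ) 1 := by
    intro d a x
    split_ifs <;> simp
  have hVRint : ∀ d : 𝒳 → ℤ, IsRule d → ∀ ω,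
      Rl ω * (if A ω = d (X ω) then (1 : ℝ) else 0) / pr (A ω) (X ω)
        = (if d (X ω) = 1 then (1 : ℝ) else 0) / pr 1 (X ω)
            * (Rl ω * (if A ω = 1 then (1 : ℝ) else 0))
          + (if d (X ω) = -1 then (1 : ℝ) else 0) / pr (-1) (X ω)
            * (Rl ω * (if A ω = -1 then (1 : ℝ) else 0)) := by
    intro d hd ω
    rcases hd.2 (X ω) with h | h <;> rcases hA1 ω with h' | h' <;> simp [h, h'] <;> ring
  have hμd : ∀ d : 𝒳 → ℤ, IsRule d → ∀ x,
      μ (d x) x = (if d x = 1 then (1 : ℝ) else 0) * μ 1 x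
        + (if d x = -1 then (1 : ℝ) else 0) * μ (-1) x := by
    intro d hd x
    rcases hd.2 x with h | h <;> simp [h]
  have hindμ : ∀ (d : 𝒳 → ℤ), IsRule d → ∀ a ∈ ({1, -1} : Set ℤ),
      Integrable (fun ω => (if d (X ω) = a then (1 : ℝ) else 0) * μ a (X ω)) P :=
    fun d hd a ha => (hμint a ha).bdd_mul (c := 1)
      ((measurable_indicator_eq hd.1 a).comp hX).aestronglyMeasurable
      (Filter.Eventually.of_forall fun ω => by split_ifs <;> simp)
  have hμdint : ∀ d : 𝒳 → ℤ, IsRule d → Integrable (fun ω => μ (d (X ω)) (X ω)) P := by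
    intro d hd
    simp only [hμd d hd]
    exact (hindμ d hd 1 m1).add (hindμ d hd (-1) m2)
  have hVR : ∀ d : 𝒳 → ℤ, IsRule d → VR P X A pr Rl d = ∫ ω, μ (d (X ω)) (X ω) ∂P := by
    intro d hd
    have hi := measurable_indicator_eq hd.1
    simp only [VR, hVRint d hd, hμd d hd]
    rw [integral_add (hwint 1 m1 _ (hi 1) (hind01 d 1) _ (hTint 1))
        (hwint (-1) m2 _ (hi (-1)) (hind01 d (-1)) _ (hTint (-1))),
      integral_add (hindμ d hd 1 m1) (hindμ d hd (-1) m2),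
      hreward 1 m1 _ (hi 1) (hind01 d 1), hreward (-1) m2 _ (hi (-1)) (hind01 d (-1))]
  have hΓ : ∀ d : 𝒳 → ℤ, IsRule d → ∀ α : 𝒜,
      VR P X A pr Rl d = ∫ ω, Gam X A pr ν Rl (d (X ω)) α ω ∂P := by
    intro d hd α
    have hi := measurable_indicator_eq hd.1
    -- the nuisance restricted to the region where `d` selects `a`
    let v : ℤ → 𝒳 → ℝ := fun a x => (if d x = a then (1 : ℝ) else 0) * ν a x α
    have hvm : ∀ a, Measurable (v a) := fun a =>
      (hi a).mul ((hν a).comp (measurable_id.prodMk measurable_const))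
    have hv : ∀ a x, v a x ∈ Set.Icc (0 : ℝ) 1 := by
      intro a x
      simp only [v]
      split_ifs
      · simpa using hν01 a x α
      · simp
    have hvint : ∀ a, Integrable (fun ω => v a (X ω)) P := fun a =>
      Integrable.of_bound (C := 1) ((hvm a).comp hX).aestronglyMeasurable
        (Filter.Eventually.of_forall fun ω => by
          rw [Real.norm_eq_abs, abs_of_nonneg (hv a _).1]; exact (hv a _).2)
    have hcorr : ∀ a ∈ ({1, -1} : Set ℤ),
        Integrable (fun ω => v a (X ω)
          - v a (X ω) / pr a (X ω) * (if A ω = a then (1 : ℝ) else 0)) P ∧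
        ∫ ω, (v a (X ω) - v a (X ω) / pr a (X ω) * (if A ω = a then (1 : ℝ) else 0)) ∂P = 0 := by
      intro a ha
      have hw := hwint a ha _ (hvm a) (hv a) _ (hIint a)
      refine ⟨(hvint a).sub hw, ?_⟩
      rw [integral_sub (hvint a) hw, hweight a ha _ (hvm a) (hv a), sub_self]
    have hVRi : Integrable
        (fun ω => Rl ω * (if A ω = d (X ω) then (1 : ℝ) else 0) / pr (A ω) (X ω)) P := by
      simp only [hVRint d hd]
      exact (hwint 1 m1 _ (hi 1) (hind01 d 1) _ (hTint 1)).add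
        (hwint (-1) m2 _ (hi (-1)) (hind01 d (-1)) _ (hTint (-1)))
    have hpt : ∀ ω, Gam X A pr ν Rl (d (X ω)) α ω
        = Rl ω * (if A ω = d (X ω) then (1 : ℝ) else 0) / pr (A ω) (X ω)
          + ((v 1 (X ω) - v 1 (X ω) / pr 1 (X ω) * (if A ω = 1 then (1 : ℝ) else 0))
            + (v (-1) (X ω)
              - v (-1) (X ω) / pr (-1) (X ω) * (if A ω = -1 then (1 : ℝ) else 0))) := by
      intro ω
      rcases hd.2 (X ω) with h | h <;> rcases hA1 ω with h' | h' <;>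
        simp [Gam, v, h, h'] <;> ring
    simp only [hpt]
    have hsum := (hcorr 1 m1).1.add (hcorr (-1) m2).1
    have e1 := integral_add hVRi hsum
    have e2 := integral_add (hcorr 1 m1).1 (hcorr (-1) m2).1
    simp only [Pi.add_apply] at e1
    rw [e1, e2, (hcorr 1 m1).2, (hcorr (-1) m2).2]
    simp [VR]
  have hred : ∀ d : 𝒳 → ℤ, IsRule d → ∀ α : 𝒜,
      VR P X A pr Rl d
        = (1 / 2) * (∫ ω, (Gam X A pr ν Rl 1 α ω + Gam X A pr ν Rl (-1) α ω
              + |Gam X A pr ν Rl 1 α ω - Gam X A pr ν Rl (-1) α ω|) ∂P)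
          - ∫ ω, |Gam X A pr ν Rl 1 α ω - Gam X A pr ν Rl (-1) α ω|
              * (if (if 0 ≤ Gam X A pr ν Rl 1 α ω - Gam X A pr ν Rl (-1) α ω
                    then (1 : ℤ) else -1) ≠ d (X ω) then (1 : ℝ) else 0) ∂P := by
    intro d hd α
    have g1 := hΓint 1 m1 α
    have g2 := hΓint (-1) m2 α
    have hC : Integrable (fun ω => (1 / 2) * (Gam X A pr ν Rl 1 α ω + Gam X A pr ν Rl (-1) α ω
        + |Gam X A pr ν Rl 1 α ω - Gam X A pr ν Rl (-1) α ω|)) P :=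
      ((g1.add g2).add (g1.sub g2).abs).const_mul _
    have hpt : ∀ ω, |Gam X A pr ν Rl 1 α ω - Gam X A pr ν Rl (-1) α ω|
              * (if (if 0 ≤ Gam X A pr ν Rl 1 α ω - Gam X A pr ν Rl (-1) α ω
                    then (1 : ℤ) else -1) ≠ d (X ω) then (1 : ℝ) else 0)
        = (1 / 2) * (Gam X A pr ν Rl 1 α ω + Gam X A pr ν Rl (-1) α ω
              + |Gam X A pr ν Rl 1 α ω - Gam X A pr ν Rl (-1) α ω|)
          - Gam X A pr ν Rl (d (X ω)) α ω := by
      intro ω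
      by_cases h0 : 0 ≤ Gam X A pr ν Rl 1 α ω - Gam X A pr ν Rl (-1) α ω
      · rw [abs_of_nonneg h0, if_pos h0]
        rcases hd.2 (X ω) with h | h <;> rw [h] <;> norm_num <;> ring
      · rw [abs_of_neg (not_le.mp h0), if_neg h0]
        rcases hd.2 (X ω) with h | h <;> rw [h] <;> norm_num <;> ring
    have hΓd : Integrable (fun ω => Gam X A pr ν Rl (d (X ω)) α ω) P := by
      have hs : MeasurableSet {ω | d (X ω) = 1} := (hd.1.comp hX) (measurableSet_singleton 1)
      refine ((g1.indicator hs).add (g2.indicator hs.compl)).congr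
        (Filter.Eventually.of_forall fun ω => ?_)
      rcases hd.2 (X ω) with h | h <;> simp [Set.indicator, h]
    simp only [hpt]
    rw [integral_sub hC hΓd, integral_const_mul, hΓ d hd α]
    ring
  have hstar : IsRule fun x => if 0 ≤ μ 1 x - μ (-1) x then (1 : ℤ) else -1 := by
    refine ⟨Measurable.ite (measurableSet_le measurable_const ((hμmeas 1).sub (hμmeas (-1))))
      measurable_const measurable_const, fun x => ?_⟩
    simp only
    split_ifs <;> simp
  have hstar_max : ∀ x, ∀ a ∈ ({1, -1} : Set ℤ),
      μ a x ≤ μ (if 0 ≤ μ 1 x - μ (-1) x then (1 : ℤ) else -1) x := by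
    intro x a ha
    rcases ha with rfl | rfl <;> split_ifs <;> linarith
  have hmem : ∀ d : 𝒳 → ℤ, IsRule d → ∀ x, d x ∈ ({1, -1} : Set ℤ) := fun d hd x => hd.2 x
  have hopt : ∀ d : 𝒳 → ℤ, IsRule d →
      (∀ᵐ ω ∂P, ∀ a ∈ ({1, -1} : Set ℤ), μ a (X ω) ≤ μ (d (X ω)) (X ω)) →
      ∀ d' : 𝒳 → ℤ, IsRule d' → VR P X A pr Rl d' ≤ VR P X A pr Rl d := by
    intro d hd hae d' hd'
    rw [hVR d hd, hVR d' hd']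
    refine integral_mono_ae (hμdint d' hd') (hμdint d hd) ?_
    filter_upwards [hae] with ω h
    exact h _ (hmem d' hd' (X ω))
  refine ⟨hΓ, hred, ?_, ?_, hopt _ hstar (Filter.Eventually.of_forall fun ω => hstar_max (X ω))⟩
  · intro α d hd
    refine forall₂_congr fun d' hd' => ?_
    rw [hred d hd α, hred d' hd' α]
    exact sub_le_sub_iff_left _
  · intro d hd
    have hμdm : Measurable fun x => μ (d x) x := by
      simp only [hμd d hd]
      exact ((measurable_indicator_eq hd.1 1).mul (hμmeas 1)).add
        ((measurable_indicator_eq hd.1 (-1)).mul (hμmeas (-1)))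
    have hset : MeasurableSet {x | ∀ a ∈ ({1, -1} : Set ℤ), μ a x ≤ μ (d x) x} := by
      simp only [Set.mem_insert_iff, Set.mem_singleton_iff, forall_eq_or_imp, forall_eq]
      exact (measurableSet_le (hμmeas 1) hμdm).inter (measurableSet_le (hμmeas (-1)) hμdm)
    rw [ae_map_iff hX.aemeasurable hset]
    refine ⟨fun h => ?_, hopt d hd⟩
    have hle := h _ hstar
    rw [hVR d hd, hVR _ hstar] at hle
    have hpos : 0 ≤ᵐ[P] fun ω =>
        μ (if 0 ≤ μ 1 (X ω) - μ (-1) (X ω) then (1 : ℤ) else -1) (X ω) - μ (d (X ω)) (X ω) :=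
      Filter.Eventually.of_forall fun ω =>
        sub_nonneg.mpr (hstar_max (X ω) _ (hmem d hd (X ω)))
    have hint := (hμdint _ hstar).sub (hμdint d hd)
    have hzero := (integral_eq_zero_iff_of_nonneg_ae hpos hint).mp (le_antisymm
      (by rw [integral_sub (hμdint _ hstar) (hμdint d hd)]; linarith)
      (integral_nonneg_of_ae hpos))
    filter_upwards [hzero] with ω hω a ha
    have h1 := hstar_max (X ω) a ha
    simp only [Pi.zero_apply] at hω
    linarith
end

section
/- Fix α ∈ 𝒜 and write p(x) := π(1|x), q(x) := π(−1|x) = 1 − p(x). Under the identification and positivity assumption, for P_X-almost every x: E[D_α(Z) | X = x] = μ_1(x) − μ_{−1}(x), and Var(D_α(Z) | X = x) = σ_1²(x)/p(x) + σ_{−1}²(x)/q(x) + [ q(x)(μ_1(x) − ν_{1,α}(x)) + p(x)(μ_{−1}(x) − ν_{−1,α}(x)) ]² / (p(x)q(x)). Hence the conditional variance of D_α(Z) at x is minimized over the pair (ν_{1,α}(x), ν_{−1,α}(x)) exactly when q(x)ν_{1,α}(x) + p(x)ν_{−1,α}(x) = q(x)μ_1(x) + p(x)μ_{−1}(x). 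-/
open MeasureTheory ProbabilityTheory Real

/-- the certified advantage `D_α(Z) = Γ_1^α(Z) − Γ_{−1}^α(Z)` -/
noncomputable def Dadv {Ω 𝒳 𝒜 : Type*} (X : Ω → 𝒳) (A : Ω → ℤ) (pr : ℤ → 𝒳 → ℝ)
    (ν : ℤ → 𝒳 → 𝒜 → ℝ) (Rl : Ω → ℝ) (α : 𝒜) (ω : Ω) : ℝ :=
  Gam X A pr ν Rl 1 α ω - Gam X A pr ν Rl (-1) α ω

/-- `f` is integrable and `h ∘ X` is a version of its conditional expectation given `X`. -/
structure HasCondExpGiven {Ω 𝒳 : Type*} [MeasurableSpace Ω] [MeasurableSpace 𝒳]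
    (P : Measure Ω) (X : Ω → 𝒳) (f : Ω → ℝ) (h : 𝒳 → ℝ) : Prop where
  integrable : Integrable f P
  condExp_ae_eq : P[f | MeasurableSpace.comap X inferInstance] =ᵐ[P] fun ω => h (X ω)

/-- `g` is measurable and essentially bounded with respect to the law of `X`. -/
structure EssBddMeas {Ω 𝒳 : Type*} [MeasurableSpace Ω] [MeasurableSpace 𝒳]
    (P : Measure Ω) (X : Ω → 𝒳) (g : 𝒳 → ℝ) : Prop where
  measurable : Measurable g
  memLp : MemLp (fun ω => g (X ω)) ⊤ P

section

variable {Ω 𝒳 : Type*} [MeasurableSpace Ω] [MeasurableSpace 𝒳] {P : Measure Ω} {X : Ω → 𝒳}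

namespace EssBddMeas

variable {g k : 𝒳 → ℝ}

lemma of_bound (hX : Measurable X) (hg : Measurable g) (C : ℝ)
    (h : ∀ᵐ ω ∂P, |g (X ω)| ≤ C) : EssBddMeas P X g :=
  ⟨hg, memLp_top_of_bound (hg.comp hX).aestronglyMeasurable C h⟩

lemma add (hg : EssBddMeas P X g) (hk : EssBddMeas P X k) :
    EssBddMeas P X (fun x => g x + k x) :=
  ⟨hg.measurable.add hk.measurable, hg.memLp.add hk.memLp⟩

lemma sub (hg : EssBddMeas P X g) (hk : EssBddMeas P X k) :
    EssBddMeas P X (fun x => g x - k x) :=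
  ⟨hg.measurable.sub hk.measurable, hg.memLp.sub hk.memLp⟩

lemma mul (hg : EssBddMeas P X g) (hk : EssBddMeas P X k) :
    EssBddMeas P X (fun x => g x * k x) :=
  ⟨hg.measurable.mul hk.measurable, hk.memLp.mul' hg.memLp⟩

lemma const_mul (hg : EssBddMeas P X g) (c : ℝ) : EssBddMeas P X (fun x => c * g x) :=
  ⟨hg.measurable.const_mul c, hg.memLp.const_mul c⟩

end EssBddMeas

namespace HasCondExpGiven

variable {f f₁ f₂ : Ω → ℝ} {h h₁ h₂ g : 𝒳 → ℝ}

lemma add (H₁ : HasCondExpGiven P X f₁ h₁) (H₂ : HasCondExpGiven P X f₂ h₂) :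
    HasCondExpGiven P X (fun ω => f₁ ω + f₂ ω) (fun x => h₁ x + h₂ x) :=
  ⟨H₁.integrable.add H₂.integrable,
    (condExp_add H₁.integrable H₂.integrable _).trans (H₁.condExp_ae_eq.add H₂.condExp_ae_eq)⟩

lemma mul_left (hg : EssBddMeas P X g) (H : HasCondExpGiven P X f h) :
    HasCondExpGiven P X (fun ω => g (X ω) * f ω) (fun x => g x * h x) := by
  have hint : Integrable (fun ω => g (X ω) * f ω) P :=
    memLp_one_iff_integrable.1 ((memLp_one_iff_integrable.2 H.integrable).mul' hg.memLp)
  refine ⟨hint, ?_⟩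
  have hmeas : StronglyMeasurable[MeasurableSpace.comap X inferInstance] fun ω => g (X ω) :=
    (hg.measurable.comp (comap_measurable X)).stronglyMeasurable
  refine (condExp_mul_of_stronglyMeasurable_left hmeas hint H.integrable).trans ?_
  filter_upwards [H.condExp_ae_eq] with ω hω
  simp [hω]

lemma of_comp [IsProbabilityMeasure P] (hX : Measurable X) (hg : EssBddMeas P X g) :
    HasCondExpGiven P X (fun ω => g (X ω)) g := by
  refine ⟨hg.memLp.integrable le_top, .of_eq ?_⟩
  exact condExp_of_stronglyMeasurable hX.comap_le
    (hg.measurable.comp (comap_measurable X)).stronglyMeasurable (hg.memLp.integrable le_top)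

/-- Mean contribution of one arm to an inverse-propensity-weighted score. -/
lemma weighted_residual {p μ v : 𝒳 → ℝ} {Y I : Ω → ℝ} (s : ℝ) (hp0 : ∀ x, p x ≠ 0)
    (hinv : EssBddMeas P X fun x => (p x)⁻¹) (hv : EssBddMeas P X v)
    (hI : HasCondExpGiven P X I p)
    (hY : HasCondExpGiven P X (fun ω => Y ω * I ω) fun x => μ x * p x) :
    HasCondExpGiven P X (fun ω => s * (Y ω - v (X ω)) / p (X ω) * I ω)
      (fun x => s * (μ x - v x)) := by
  convert (hY.mul_left (hinv.const_mul s)).add (hI.mul_left ((hinv.mul hv).const_mul (-s)))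
    using 1
  · ext ω; ring
  · ext x; have := hp0 x; field_simp; ring

/-- Second-moment contribution of one arm to an inverse-propensity-weighted score. -/
lemma sq_weighted_residual {p μ σsq c : 𝒳 → ℝ} {Y I : Ω → ℝ} (s : ℝ) (hp0 : ∀ x, p x ≠ 0)
    (hinv : EssBddMeas P X fun x => (p x)⁻¹) (hμ : EssBddMeas P X μ) (hc : EssBddMeas P X c)
    (hI : HasCondExpGiven P X I p)
    (hY : HasCondExpGiven P X (fun ω => Y ω * I ω) fun x => μ x * p x)
    (hS : HasCondExpGiven P X (fun ω => (Y ω - μ (X ω)) ^ 2 * I ω) fun x => σsq x * p x) :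
    HasCondExpGiven P X (fun ω => (s * (Y ω - μ (X ω)) / p (X ω) + c (X ω)) ^ 2 * I ω)
      (fun x => s ^ 2 * σsq x / p x + c x ^ 2 * p x) := by
  convert ((hS.mul_left ((hinv.mul hinv).const_mul (s ^ 2))).add
    (hY.mul_left ((hc.mul hinv).const_mul (2 * s)))).add
    (hI.mul_left ((hc.mul hc).sub (((hc.mul hinv).mul hμ).const_mul (2 * s)))) using 1
  · ext ω; ring
  · ext x; have := hp0 x; field_simp; ring

end HasCondExpGiven

end

/-- **Conditional moments of the certified advantage and the variance-minimizing nuisances.** -/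
theorem advantage_conditional_moments
    {Ω 𝒳 𝒜 : Type*} [MeasurableSpace Ω] [MeasurableSpace 𝒳] [MeasurableSpace 𝒜]
    (P : Measure Ω) [IsProbabilityMeasure P]
    (X : Ω → 𝒳) (hX : Measurable X)
    (A : Ω → ℤ) (hA : Measurable A) (hA1 : ∀ ω, A ω = 1 ∨ A ω = -1)
    (R : Ω → ℝ) (hR : Measurable R) (hR01 : ∀ ω, R ω ∈ Set.Icc (0 : ℝ) 1)
    (Rl : Ω → ℝ) (hRl : Measurable Rl) (hRl01 : ∀ ω, Rl ω ∈ Set.Icc (0 : ℝ) 1)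
    (pr : ℤ → 𝒳 → ℝ) (hpr : ∀ a, Measurable (pr a))
    (hprver : ∀ a ∈ ({1, -1} : Set ℤ),
      (P[(fun ω => if A ω = a then (1 : ℝ) else 0) |
          MeasurableSpace.comap X inferInstance]) =ᵐ[P] fun ω => pr a (X ω))
    (ε : ℝ) (hε : ε ∈ Set.Ioc (0 : ℝ) (1 / 2))
    (hprε : ∀ a ∈ ({1, -1} : Set ℤ), ∀ x, ε ≤ pr a x)
    (ν : ℤ → 𝒳 → 𝒜 → ℝ)
    (hν : ∀ a, Measurable fun q : 𝒳 × 𝒜 => ν a q.1 q.2)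
    (hν01 : ∀ a x α, ν a x α ∈ Set.Icc (0 : ℝ) 1)
    (μ : ℤ → 𝒳 → ℝ) (hμmeas : ∀ a, Measurable (μ a))
    (hμ : ∀ a ∈ ({1, -1} : Set ℤ),
      (P[(fun ω => Rl ω * (if A ω = a then (1 : ℝ) else 0)) |
          MeasurableSpace.comap X inferInstance])
        =ᵐ[P] fun ω => μ a (X ω) * pr a (X ω))
    (σsq : ℤ → 𝒳 → ℝ) (hσmeas : ∀ a, Measurable (σsq a))
    (hσ : ∀ a ∈ ({1, -1} : Set ℤ),
      (P[(fun ω => (Rl ω - μ a (X ω)) ^ 2 * (if A ω = a then (1 : ℝ) else 0)) |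
          MeasurableSpace.comap X inferInstance])
        =ᵐ[P] fun ω => σsq a (X ω) * pr a (X ω))
    -- fix `α ∈ 𝒜`
    (α : 𝒜) :
    -- conditional mean: `E[D_α(Z) | X = x] = μ₁(x) − μ₋₁(x)`
    ((P[(fun ω => Dadv X A pr ν Rl α ω) | MeasurableSpace.comap X inferInstance])
        =ᵐ[P] fun ω => μ 1 (X ω) - μ (-1) (X ω)) ∧
    -- conditional variance formula
    ((P[(fun ω => (Dadv X A pr ν Rl α ω - (μ 1 (X ω) - μ (-1) (X ω))) ^ 2) |
          MeasurableSpace.comap X inferInstance])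
        =ᵐ[P] fun ω =>
          σsq 1 (X ω) / pr 1 (X ω) + σsq (-1) (X ω) / pr (-1) (X ω)
            + (pr (-1) (X ω) * (μ 1 (X ω) - ν 1 (X ω) α)
                + pr 1 (X ω) * (μ (-1) (X ω) - ν (-1) (X ω) α)) ^ 2
              / (pr 1 (X ω) * pr (-1) (X ω))) ∧
    -- minimization over the pair of nuisance values, exactly on the linear constraint
    (∀ᵐ x ∂(P.map X), ∀ v₁ v₂ : ℝ,
      (σsq 1 x / pr 1 x + σsq (-1) x / pr (-1) x
          ≤ σsq 1 x / pr 1 x + σsq (-1) x / pr (-1) x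
            + (pr (-1) x * (μ 1 x - v₁) + pr 1 x * (μ (-1) x - v₂)) ^ 2
              / (pr 1 x * pr (-1) x)) ∧
      ((σsq 1 x / pr 1 x + σsq (-1) x / pr (-1) x
            + (pr (-1) x * (μ 1 x - v₁) + pr 1 x * (μ (-1) x - v₂)) ^ 2
              / (pr 1 x * pr (-1) x)
          = σsq 1 x / pr 1 x + σsq (-1) x / pr (-1) x)
        ↔ pr (-1) x * v₁ + pr 1 x * v₂ = pr (-1) x * μ 1 x + pr 1 x * μ (-1) x)) := by
  have h1 : (1 : ℤ) ∈ ({1, -1} : Set ℤ) := by simp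
  have h2 : (-1 : ℤ) ∈ ({1, -1} : Set ℤ) := by simp
  have hpos : ∀ a ∈ ({1, -1} : Set ℤ), ∀ x, 0 < pr a x :=
    fun a ha x => hε.1.trans_le (hprε a ha x)
  have hne : ∀ a ∈ ({1, -1} : Set ℤ), ∀ x, pr a x ≠ 0 := fun a ha x => (hpos a ha x).ne'
  set I : ℤ → Ω → ℝ := fun a ω => if A ω = a then (1 : ℝ) else 0 with hIdef
  have hImeas : ∀ a, Measurable (I a) := fun a =>
    Measurable.ite (hA (measurableSet_singleton a)) measurable_const measurable_const
  have hI0 : ∀ a ω, 0 ≤ I a ω := fun a ω => by simp only [hIdef]; split_ifs <;> norm_num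
  have hI1 : ∀ a ω, I a ω ≤ 1 := fun a ω => by simp only [hIdef]; split_ifs <;> norm_num
  have hIint : ∀ a, Integrable (I a) P := fun a =>
    Integrable.of_bound (hImeas a).aestronglyMeasurable 1
      (ae_of_all _ fun ω => by rw [Real.norm_eq_abs, abs_of_nonneg (hI0 a ω)]; exact hI1 a ω)
  have hIc : ∀ a ∈ ({1, -1} : Set ℤ), HasCondExpGiven P X (I a) (pr a) :=
    fun a ha => ⟨hIint a, hprver a ha⟩
  have hRI0 : ∀ a ω, 0 ≤ Rl ω * I a ω := fun a ω => mul_nonneg (hRl01 ω).1 (hI0 a ω)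
  have hRI1 : ∀ a ω, Rl ω * I a ω ≤ I a ω := fun a ω =>
    mul_le_of_le_one_left (hI0 a ω) (hRl01 ω).2
  have hRIint : ∀ a, Integrable (fun ω => Rl ω * I a ω) P := fun a =>
    (hIint a).mono (hRl.mul (hImeas a)).aestronglyMeasurable (ae_of_all _ fun ω => by
      rw [Real.norm_eq_abs, Real.norm_eq_abs, abs_of_nonneg (hRI0 a ω), abs_of_nonneg (hI0 a ω)]
      exact hRI1 a ω)
  have hYc : ∀ a ∈ ({1, -1} : Set ℤ),
      HasCondExpGiven P X (fun ω => Rl ω * I a ω) (fun x => μ a x * pr a x) :=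
    fun a ha => ⟨hRIint a, hμ a ha⟩
  have hμ01 : ∀ a ∈ ({1, -1} : Set ℤ), ∀ᵐ ω ∂P, 0 ≤ μ a (X ω) ∧ μ a (X ω) ≤ 1 := by
    intro a ha
    have hlo := condExp_nonneg (m := MeasurableSpace.comap X inferInstance) (μ := P)
      (ae_of_all _ (hRI0 a))
    have hhi := condExp_mono (m := MeasurableSpace.comap X inferInstance)
      (hRIint a) (hIint a) (ae_of_all _ (hRI1 a))
    filter_upwards [hlo, hhi, (hYc a ha).condExp_ae_eq, (hIc a ha).condExp_ae_eq]
      with ω h0 h1 hY hI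
    have hp := hpos a ha (X ω)
    rw [hY] at h0 h1
    rw [hI] at h1
    exact ⟨nonneg_of_mul_nonneg_left h0 hp, by nlinarith⟩
  have hμb : ∀ a ∈ ({1, -1} : Set ℤ), EssBddMeas P X (μ a) := fun a ha =>
    .of_bound hX (hμmeas a) 1 ((hμ01 a ha).mono fun ω h => by
      rw [abs_of_nonneg h.1]; exact h.2)
  have hνb : ∀ a, EssBddMeas P X fun x => ν a x α := fun a =>
    .of_bound hX ((hν a).comp (measurable_id.prodMk measurable_const)) 1
      (ae_of_all _ fun ω => by
        rw [abs_of_nonneg (hν01 a (X ω) α).1]; exact (hν01 a (X ω) α).2)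
  have hinv : ∀ a ∈ ({1, -1} : Set ℤ), EssBddMeas P X fun x => (pr a x)⁻¹ := fun a ha =>
    .of_bound hX (hpr a).inv ε⁻¹ (ae_of_all _ fun ω => by
      rw [abs_of_pos (inv_pos.2 (hpos a ha (X ω)))]
      exact inv_anti₀ hε.1 (hprε a ha (X ω)))
  have hSc : ∀ a ∈ ({1, -1} : Set ℤ), HasCondExpGiven P X
      (fun ω => (Rl ω - μ a (X ω)) ^ 2 * I a ω) (fun x => σsq a x * pr a x) := by
    intro a ha
    refine ⟨Integrable.of_bound ((((hRl.sub ((hμmeas a).comp hX)).pow_const 2).mul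
      (hImeas a)).aestronglyMeasurable) 1 ?_, hσ a ha⟩
    filter_upwards [hμ01 a ha] with ω h
    rw [Real.norm_eq_abs, abs_of_nonneg (mul_nonneg (sq_nonneg _) (hI0 a ω))]
    have hR := hRl01 ω
    exact mul_le_one₀ ((sq_le_one_iff_abs_le_one _).2
      (abs_le.2 ⟨by linarith [hR.1, h.2], by linarith [hR.2, h.1]⟩)) (hI0 a ω) (hI1 a ω)
  have hsum : ∀ᵐ ω ∂P, pr 1 (X ω) + pr (-1) (X ω) = 1 := by
    have hadd := ((hIc 1 h1).add (hIc (-1) h2)).condExp_ae_eq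
    have hone : (fun ω => I 1 ω + I (-1) ω) = fun _ => (1 : ℝ) := by
      ext ω
      rcases hA1 ω with h | h <;> simp [hIdef, h]
    rw [hone, condExp_const hX.comap_le] at hadd
    exact hadd.mono fun ω h => h.symm
  refine ⟨?_, ?_, ?_⟩
  · have H := ((HasCondExpGiven.of_comp hX ((hνb 1).sub (hνb (-1)))).add
      (HasCondExpGiven.weighted_residual 1 (hne 1 h1) (hinv 1 h1) (hνb 1)
        (hIc 1 h1) (hYc 1 h1))).add
      (HasCondExpGiven.weighted_residual (-1) (hne (-1) h2) (hinv (-1) h2) (hνb (-1))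
        (hIc (-1) h2) (hYc (-1) h2))
    convert H.condExp_ae_eq using 1
    · congr 1
      ext ω
      simp only [Dadv, Gam, hIdef]
      ring
    · ext ω
      ring
  · have hb : EssBddMeas P X fun x => ν 1 x α - ν (-1) x α - (μ 1 x - μ (-1) x) :=
      ((hνb 1).sub (hνb (-1))).sub ((hμb 1 h1).sub (hμb (-1) h2))
    have H := (HasCondExpGiven.sq_weighted_residual 1 (hne 1 h1) (hinv 1 h1) (hμb 1 h1)
        ((((hμb 1 h1).sub (hνb 1)).mul (hinv 1 h1)).add hb)
        (hIc 1 h1) (hYc 1 h1) (hSc 1 h1)).add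
      (HasCondExpGiven.sq_weighted_residual (-1) (hne (-1) h2) (hinv (-1) h2) (hμb (-1) h2)
        (hb.sub (((hμb (-1) h2).sub (hνb (-1))).mul (hinv (-1) h2)))
        (hIc (-1) h2) (hYc (-1) h2) (hSc (-1) h2))
    refine Filter.EventuallyEq.trans (.of_eq ?_) (H.condExp_ae_eq.trans ?_)
    · congr 1
      ext ω
      rcases hA1 ω with h | h <;> simp [Dadv, Gam, hIdef, h] <;> ring
    · filter_upwards [hsum] with ω hω
      have hp := hne 1 h1 (X ω)
      have hq := hne (-1) h2 (X ω)
      have hp1 : pr 1 (X ω) = 1 - pr (-1) (X ω) := by linarith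
      rw [hp1] at hp ⊢
      field_simp
      ring
  · refine ae_of_all _ fun x v₁ v₂ => ?_
    have hpq : 0 < pr 1 x * pr (-1) x := mul_pos (hpos 1 h1 x) (hpos (-1) h2 x)
    refine ⟨le_add_of_nonneg_right (div_nonneg (sq_nonneg _) hpq.le), ?_⟩
    rw [add_eq_left, div_eq_zero_iff, or_iff_left hpq.ne', sq_eq_zero_iff]
    constructor <;> intro h <;> linarith
end

section
/- In the treatment-free subclass ν_{1,α} = ν_{−1,α} = m_α, under the identification and positivity assumption, for P_X-almost every x the unique minimizer over m_α(x) of the conditional variance Var(D_α(Z) | X = x) is m†(x) = q(x)μ_1(x) + p(x)μ_{−1}(x), where p(x) := π(1|x) and q(x) := π(−1|x). In the balanced-randomization case p(x) = q(x) = 1/2, this simplifies to m†(x) = E[R̲ | X = x]. -/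
open MeasureTheory ProbabilityTheory Real

/-- the certified advantage `D_α(Z)` in the treatment-free subclass `ν_{1,α} = ν_{−1,α} = m` -/
noncomputable def Dtf {Ω 𝒳 : Type*} (X : Ω → 𝒳) (A : Ω → ℤ) (pr : ℤ → 𝒳 → ℝ)
    (Rl : Ω → ℝ) (m : 𝒳 → ℝ) (ω : Ω) : ℝ :=
  (m (X ω) + (if A ω = 1 then (1 : ℝ) else 0) / pr 1 (X ω) * (Rl ω - m (X ω)))
    - (m (X ω) + (if A ω = -1 then (1 : ℝ) else 0) / pr (-1) (X ω) * (Rl ω - m (X ω)))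

/-- Pull-out property for an essentially bounded function of `X`. -/
theorem condExp_comp_mul {Ω 𝒳 : Type*} [MeasurableSpace Ω] [m𝒳 : MeasurableSpace 𝒳]
    {P : Measure Ω} [IsFiniteMeasure P] {X : Ω → 𝒳} {f : 𝒳 → ℝ} (hf : Measurable f)
    (hfb : MemLp (fun ω => f (X ω)) ⊤ P) {g h : Ω → ℝ} (hg : Integrable g P)
    (hgh : P[g | m𝒳.comap X] =ᵐ[P] h) :
    P[fun ω => f (X ω) * g ω | m𝒳.comap X] =ᵐ[P] fun ω => f (X ω) * h ω := by
  have hsm : StronglyMeasurable[m𝒳.comap X] (fun ω => f (X ω)) :=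
    (hf.comp (comap_measurable X)).stronglyMeasurable
  have hint : Integrable ((fun ω => f (X ω)) * g) P := hg.mul_of_top_right hfb
  filter_upwards [condExp_mul_of_stronglyMeasurable_left hsm hint hg, hgh] with ω h₁ h₂
  rw [← h₂]
  exact h₁

/-- Conditional second moment, on the event encoded by `I`, of an affine function of `Y` whose
coefficients are functions of `X`. -/
theorem condExp_affine_sq_mul {Ω 𝒳 : Type*} [MeasurableSpace Ω] [m𝒳 : MeasurableSpace 𝒳]
    {P : Measure Ω} [IsFiniteMeasure P] {X : Ω → 𝒳} {Y I : Ω → ℝ}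
    (hY : MemLp Y ⊤ P) (hI : MemLp I ⊤ P) {p μ s b c : 𝒳 → ℝ}
    (hμ : Measurable μ) (hb : Measurable b) (hc : Measurable c)
    (hμb : MemLp (fun ω => μ (X ω)) ⊤ P) (hbb : MemLp (fun ω => b (X ω)) ⊤ P)
    (hcb : MemLp (fun ω => c (X ω)) ⊤ P)
    (hp : P[I | m𝒳.comap X] =ᵐ[P] fun ω => p (X ω))
    (hYI : P[fun ω => Y ω * I ω | m𝒳.comap X] =ᵐ[P] fun ω => μ (X ω) * p (X ω))
    (hs : P[fun ω => (Y ω - μ (X ω)) ^ 2 * I ω | m𝒳.comap X]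
      =ᵐ[P] fun ω => s (X ω) * p (X ω)) :
    Integrable (fun ω => (b (X ω) * (Y ω - μ (X ω)) + c (X ω)) ^ 2 * I ω) P ∧
    P[fun ω => (b (X ω) * (Y ω - μ (X ω)) + c (X ω)) ^ 2 * I ω | m𝒳.comap X]
      =ᵐ[P] fun ω => b (X ω) ^ 2 * (s (X ω) * p (X ω)) + c (X ω) ^ 2 * p (X ω) := by
  have hmul : ∀ {f g : Ω → ℝ}, MemLp f ⊤ P → MemLp g ⊤ P → MemLp (fun ω => f ω * g ω) ⊤ P :=
    fun hf hg => hg.mul (p := ⊤) (q := ⊤) hf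
  have hint : ∀ {f : Ω → ℝ}, MemLp f ⊤ P → Integrable f P := fun hf => hf.integrable le_top
  have hd : MemLp (fun ω => (Y ω - μ (X ω)) ^ 2 * I ω) ⊤ P := by
    simpa only [sq, Pi.sub_apply] using hmul (hmul (hY.sub hμb) (hY.sub hμb)) hI
  have hb2 : MemLp (fun ω => b (X ω) ^ 2) ⊤ P := by simpa only [sq] using hmul hbb hbb
  have hc2 : MemLp (fun ω => c (X ω) ^ 2) ⊤ P := by simpa only [sq] using hmul hcb hcb
  have hbc : MemLp (fun ω => 2 * (b (X ω) * c (X ω))) ⊤ P := (hmul hbb hcb).const_mul 2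
  have hbcμ : MemLp (fun ω => c (X ω) ^ 2 - 2 * (b (X ω) * c (X ω)) * μ (X ω)) ⊤ P :=
    hc2.sub (hmul hbc hμb)
  have e₁ := condExp_comp_mul (f := fun x => b x ^ 2) (by fun_prop) hb2 (hint hd) hs
  have e₂ := condExp_comp_mul (f := fun x => 2 * (b x * c x)) (by fun_prop) hbc
    (hint (hmul hY hI)) hYI
  have e₃ := condExp_comp_mul (f := fun x => c x ^ 2 - 2 * (b x * c x) * μ x) (by fun_prop) hbcμ
    (hint hI) hp
  have i₁ := hint (hmul hb2 hd)
  have i₂ := hint (hmul hbc (hmul hY hI))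
  have i₃ := hint (hmul hbcμ hI)
  have hexp : (fun ω => (b (X ω) * (Y ω - μ (X ω)) + c (X ω)) ^ 2 * I ω) =
      ((fun ω => b (X ω) ^ 2 * ((Y ω - μ (X ω)) ^ 2 * I ω)) +
        fun ω => 2 * (b (X ω) * c (X ω)) * (Y ω * I ω)) +
        fun ω => (c (X ω) ^ 2 - 2 * (b (X ω) * c (X ω)) * μ (X ω)) * I ω := by
    funext ω
    simp only [Pi.add_apply]
    ring
  rw [hexp]
  refine ⟨(i₁.add i₂).add i₃, ?_⟩
  filter_upwards [condExp_add (i₁.add i₂) i₃ (m𝒳.comap X), condExp_add i₁ i₂ (m𝒳.comap X),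
    e₁, e₂, e₃] with ω h₁ h₂ h₃ h₄ h₅
  rw [h₁, Pi.add_apply, h₂, Pi.add_apply, h₃, h₄, h₅]
  ring

/-- A regression function on an event of positive conditional probability inherits the bounds of
the response. -/
theorem mem_Icc_of_condExp_mul {Ω 𝒳 : Type*} [MeasurableSpace Ω] [m𝒳 : MeasurableSpace 𝒳]
    {P : Measure Ω} [IsFiniteMeasure P] {X : Ω → 𝒳} {Y I : Ω → ℝ}
    (hY : MemLp Y ⊤ P) (hI : MemLp I ⊤ P)
    (hY01 : ∀ ω, Y ω ∈ Set.Icc (0 : ℝ) 1) (hI0 : ∀ ω, 0 ≤ I ω) {p μ : 𝒳 → ℝ}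
    (hp0 : ∀ x, 0 < p x)
    (hp : P[I | m𝒳.comap X] =ᵐ[P] fun ω => p (X ω))
    (hYI : P[fun ω => Y ω * I ω | m𝒳.comap X] =ᵐ[P] fun ω => μ (X ω) * p (X ω)) :
    ∀ᵐ ω ∂P, μ (X ω) ∈ Set.Icc (0 : ℝ) 1 := by
  have hYIi : Integrable (fun ω => Y ω * I ω) P :=
    (hI.mul (p := ⊤) (q := ⊤) (r := ⊤) hY).integrable le_top
  have hle : P[fun ω => Y ω * I ω | m𝒳.comap X] ≤ᵐ[P] P[I | m𝒳.comap X] :=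
    condExp_mono hYIi (hI.integrable le_top)
      (ae_of_all _ fun ω => mul_le_of_le_one_left (hI0 ω) (hY01 ω).2)
  have hnn : 0 ≤ᵐ[P] P[fun ω => Y ω * I ω | m𝒳.comap X] :=
    condExp_nonneg (ae_of_all _ fun ω => mul_nonneg (hY01 ω).1 (hI0 ω))
  filter_upwards [hle, hnn, hp, hYI] with ω h₁ h₂ h₃ h₄
  have hpos := hp0 (X ω)
  rw [h₃, h₄] at h₁
  rw [h₄] at h₂
  exact ⟨nonneg_of_mul_nonneg_left h₂ hpos, by nlinarith⟩

/-- **Variance-optimal treatment-free nuisance.** -/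
theorem treatment_free_variance_optimal_nuisance
    {Ω 𝒳 : Type*} [MeasurableSpace Ω] [MeasurableSpace 𝒳]
    (P : Measure Ω) [IsProbabilityMeasure P]
    (X : Ω → 𝒳) (hX : Measurable X)
    (A : Ω → ℤ) (hA : Measurable A) (hA1 : ∀ ω, A ω = 1 ∨ A ω = -1)
    (R : Ω → ℝ) (hR : Measurable R) (hR01 : ∀ ω, R ω ∈ Set.Icc (0 : ℝ) 1)
    (Rl : Ω → ℝ) (hRl : Measurable Rl) (hRl01 : ∀ ω, Rl ω ∈ Set.Icc (0 : ℝ) 1)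
    (pr : ℤ → 𝒳 → ℝ) (hpr : ∀ a, Measurable (pr a))
    (hprver : ∀ a ∈ ({1, -1} : Set ℤ),
      (P[(fun ω => if A ω = a then (1 : ℝ) else 0) |
          MeasurableSpace.comap X inferInstance]) =ᵐ[P] fun ω => pr a (X ω))
    (ε : ℝ) (hε : ε ∈ Set.Ioc (0 : ℝ) (1 / 2))
    (hprε : ∀ a ∈ ({1, -1} : Set ℤ), ∀ x, ε ≤ pr a x)
    (μ : ℤ → 𝒳 → ℝ) (hμmeas : ∀ a, Measurable (μ a))
    (hμ : ∀ a ∈ ({1, -1} : Set ℤ),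
      (P[(fun ω => Rl ω * (if A ω = a then (1 : ℝ) else 0)) |
          MeasurableSpace.comap X inferInstance])
        =ᵐ[P] fun ω => μ a (X ω) * pr a (X ω))
    (σsq : ℤ → 𝒳 → ℝ) (hσmeas : ∀ a, Measurable (σsq a))
    (hσ : ∀ a ∈ ({1, -1} : Set ℤ),
      (P[(fun ω => (Rl ω - μ a (X ω)) ^ 2 * (if A ω = a then (1 : ℝ) else 0)) |
          MeasurableSpace.comap X inferInstance])
        =ᵐ[P] fun ω => σsq a (X ω) * pr a (X ω))
    -- `E[R̲ | X = x]`
    (μbar : 𝒳 → ℝ) (hμbarmeas : Measurable μbar)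
    (hμbar : (P[Rl | MeasurableSpace.comap X inferInstance])
        =ᵐ[P] fun ω => μbar (X ω)) :
    -- conditional variance of `D` in the treatment-free subclass, as a function of `m`
    (∀ m : 𝒳 → ℝ, Measurable m → (∀ x, m x ∈ Set.Icc (0 : ℝ) 1) →
      (P[(fun ω => (Dtf X A pr Rl m ω - (μ 1 (X ω) - μ (-1) (X ω))) ^ 2) |
          MeasurableSpace.comap X inferInstance])
        =ᵐ[P] fun ω =>
          σsq 1 (X ω) / pr 1 (X ω) + σsq (-1) (X ω) / pr (-1) (X ω)
            + ((pr (-1) (X ω) * μ 1 (X ω) + pr 1 (X ω) * μ (-1) (X ω)) - m (X ω)) ^ 2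
              / (pr 1 (X ω) * pr (-1) (X ω))) ∧
    -- `m†(x) = q(x)μ₁(x) + p(x)μ₋₁(x)` is the unique minimizer of that conditional variance
    (∀ᵐ x ∂(P.map X), ∀ v : ℝ, v ≠ pr (-1) x * μ 1 x + pr 1 x * μ (-1) x →
      σsq 1 x / pr 1 x + σsq (-1) x / pr (-1) x
        < σsq 1 x / pr 1 x + σsq (-1) x / pr (-1) x
          + ((pr (-1) x * μ 1 x + pr 1 x * μ (-1) x) - v) ^ 2
            / (pr 1 x * pr (-1) x)) ∧
    -- balanced randomization: `p(x) = q(x) = 1/2` gives `m†(x) = E[R̲ | X = x]`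
    ((∀ x, pr 1 x = 1 / 2 ∧ pr (-1) x = 1 / 2) →
      ∀ᵐ x ∂(P.map X),
        pr (-1) x * μ 1 x + pr 1 x * μ (-1) x = μbar x) := by
  have hm : MeasurableSpace.comap X inferInstance ≤ ‹MeasurableSpace Ω› := hX.comap_le
  have m1 : (1 : ℤ) ∈ ({1, -1} : Set ℤ) := by simp
  have m2 : (-1 : ℤ) ∈ ({1, -1} : Set ℤ) := by simp
  have hp0 : ∀ a ∈ ({1, -1} : Set ℤ), ∀ x, 0 < pr a x := fun a ha x => hε.1.trans_le (hprε a ha x)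
  have bdd : ∀ {f : Ω → ℝ}, Measurable f → ∀ C : ℝ, (∀ᵐ ω ∂P, |f ω| ≤ C) → MemLp f ⊤ P :=
    fun hf C h => memLp_top_of_bound hf.aestronglyMeasurable C h
  have hImeas : ∀ a, Measurable (fun ω => if A ω = a then (1 : ℝ) else 0) := fun a =>
    Measurable.ite (hA (measurableSet_singleton a)) measurable_const measurable_const
  have hI : ∀ a, MemLp (fun ω => if A ω = a then (1 : ℝ) else 0) ⊤ P := fun a =>
    bdd (hImeas a) 1 (ae_of_all _ fun ω => by split_ifs <;> simp)
  have hRlb : MemLp Rl ⊤ P := bdd hRl 1 (ae_of_all _ fun ω => by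
    rw [abs_of_nonneg (hRl01 ω).1]; exact (hRl01 ω).2)
  have hμb : ∀ a ∈ ({1, -1} : Set ℤ), MemLp (fun ω => μ a (X ω)) ⊤ P := fun a ha =>
    bdd ((hμmeas a).comp hX) 1 (by
      filter_upwards [mem_Icc_of_condExp_mul hRlb (hI a) hRl01
        (fun ω => by split_ifs <;> simp) (hp0 a ha) (hprver a ha) (hμ a ha)] with ω h
      rw [abs_of_nonneg h.1]
      exact h.2)
  have hinv : ∀ a ∈ ({1, -1} : Set ℤ), MemLp (fun ω => (pr a (X ω))⁻¹) ⊤ P := fun a ha =>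
    bdd ((hpr a).comp hX).inv ε⁻¹ (ae_of_all _ fun ω => by
      rw [abs_of_pos (inv_pos.2 (hp0 a ha _))]
      exact inv_anti₀ hε.1 (hprε a ha _))
  have hIsum : ∀ ω, (if A ω = 1 then (1 : ℝ) else 0) + (if A ω = -1 then (1 : ℝ) else 0) = 1 := by
    intro ω
    rcases hA1 ω with h | h <;> simp [h]
  refine ⟨?_, ?_, ?_⟩
  · intro m hmm hm01
    have hpq : ∀ᵐ ω ∂P, pr 1 (X ω) + pr (-1) (X ω) = 1 := by
      have h1 := condExp_add ((hI 1).integrable le_top) ((hI (-1)).integrable le_top)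
        (MeasurableSpace.comap X inferInstance)
      have h2 : ((fun ω => if A ω = 1 then (1 : ℝ) else 0) +
          fun ω => if A ω = -1 then (1 : ℝ) else 0) = fun _ => 1 := funext hIsum
      rw [h2, condExp_const hm] at h1
      filter_upwards [h1, hprver 1 m1, hprver (-1) m2] with ω e₁ e₂ e₃
      rw [Pi.add_apply, e₂, e₃] at e₁
      exact e₁.symm
    have hmb : MemLp (fun ω => m (X ω)) ⊤ P := bdd (hmm.comp hX) 1 (ae_of_all _ fun ω => by
      rw [abs_of_nonneg (hm01 _).1]; exact (hm01 _).2)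
    have hμ₁ := hμmeas 1
    have hμ₂ := hμmeas (-1)
    have hp₁ := hpr 1
    have hp₂ := hpr (-1)
    have hmul : ∀ {f g : Ω → ℝ}, MemLp f ⊤ P → MemLp g ⊤ P → MemLp (fun ω => f ω * g ω) ⊤ P :=
      fun hf hg => hg.mul (p := ⊤) (q := ⊤) hf
    have hτ : MemLp (fun ω => μ 1 (X ω) - μ (-1) (X ω)) ⊤ P := (hμb 1 m1).sub (hμb (-1) m2)
    obtain ⟨i₁, e₁⟩ := condExp_affine_sq_mul (b := fun x => (pr 1 x)⁻¹)
      (c := fun x => (pr 1 x)⁻¹ * (μ 1 x - m x) - (μ 1 x - μ (-1) x)) hRlb (hI 1) hμ₁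
      (by fun_prop) (by fun_prop) (hμb 1 m1) (hinv 1 m1)
      ((hmul (hinv 1 m1) ((hμb 1 m1).sub hmb)).sub hτ) (hprver 1 m1) (hμ 1 m1) (hσ 1 m1)
    obtain ⟨i₂, e₂⟩ := condExp_affine_sq_mul (b := fun x => -(pr (-1) x)⁻¹)
      (c := fun x => -(pr (-1) x)⁻¹ * (μ (-1) x - m x) - (μ 1 x - μ (-1) x)) hRlb (hI (-1)) hμ₂
      (by fun_prop) (by fun_prop) (hμb (-1) m2) (hinv (-1) m2).neg
      ((hmul (hinv (-1) m2).neg ((hμb (-1) m2).sub hmb)).sub hτ)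
      (hprver (-1) m2) (hμ (-1) m2) (hσ (-1) m2)
    have hsplit : (fun ω => (Dtf X A pr Rl m ω - (μ 1 (X ω) - μ (-1) (X ω))) ^ 2) =
        (fun ω => ((pr 1 (X ω))⁻¹ * (Rl ω - μ 1 (X ω)) +
          ((pr 1 (X ω))⁻¹ * (μ 1 (X ω) - m (X ω)) - (μ 1 (X ω) - μ (-1) (X ω)))) ^ 2 *
            (if A ω = 1 then (1 : ℝ) else 0)) +
        (fun ω => (-(pr (-1) (X ω))⁻¹ * (Rl ω - μ (-1) (X ω)) +
          (-(pr (-1) (X ω))⁻¹ * (μ (-1) (X ω) - m (X ω)) - (μ 1 (X ω) - μ (-1) (X ω)))) ^ 2 *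
            (if A ω = -1 then (1 : ℝ) else 0)) := by
      funext ω
      rcases hA1 ω with h | h <;> simp [Dtf, h] <;> ring
    rw [hsplit]
    filter_upwards [condExp_add i₁ i₂ (MeasurableSpace.comap X inferInstance), e₁, e₂, hpq]
      with ω h₁ h₂ h₃ h₄
    rw [h₁, Pi.add_apply, h₂, h₃]
    have hq : pr (-1) (X ω) = 1 - pr 1 (X ω) := by linarith
    have n₁ := (hp0 1 m1 (X ω)).ne'
    have n₂ := (hp0 (-1) m2 (X ω)).ne'
    rw [hq] at n₂ ⊢
    field_simp
    ring
  · refine ae_of_all _ fun x v hv => lt_add_of_pos_right _ ?_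
    exact div_pos (sq_pos_of_ne_zero (sub_ne_zero.2 hv.symm))
      (mul_pos (hp0 1 m1 x) (hp0 (-1) m2 x))
  · intro hbal
    have hμ₁ := hμmeas 1
    have hμ₂ := hμmeas (-1)
    have hp₁ := hpr 1
    have hp₂ := hpr (-1)
    rw [ae_map_iff hX.aemeasurable (measurableSet_eq_fun (by fun_prop) hμbarmeas)]
    have hRI : ∀ a, Integrable (fun ω => Rl ω * (if A ω = a then (1 : ℝ) else 0)) P := fun a =>
      ((hI a).mul (p := ⊤) (q := ⊤) (r := ⊤) hRlb).integrable le_top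
    have hsplit : (fun ω => Rl ω * (if A ω = 1 then (1 : ℝ) else 0)) +
        (fun ω => Rl ω * (if A ω = -1 then (1 : ℝ) else 0)) = Rl := by
      funext ω
      rw [Pi.add_apply, ← mul_add, hIsum, mul_one]
    have h := condExp_add (hRI 1) (hRI (-1)) (MeasurableSpace.comap X inferInstance)
    rw [hsplit] at h
    filter_upwards [h, hμbar, hμ 1 m1, hμ (-1) m2] with ω h₁ h₂ h₃ h₄
    rw [h₂, Pi.add_apply, h₃, h₄] at h₁
    rw [h₁, (hbal (X ω)).1, (hbal (X ω)).2]
    ring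
end

section
/- Let ℓ : Θ × 𝒵 → [0,1] be a measurable loss, let Z_1, …, Z_n be i.i.d. 𝒵-valued random variables, and define L(θ) := E[ℓ(θ; Z_1)], L̂_n(θ) := n^{−1} Σ_{i=1}^n ℓ(θ; Z_i), and for any posterior Q ≪ Π0 the aggregates L(Q) := E_{θ∼Q}[L(θ)] and L̂_n(Q) := E_{θ∼Q}[L̂_n(θ)]. Then for every δ ∈ (0,1), with probability at least 1 − δ, the inequality kl( L̂_n(Q) ‖ L(Q) ) ≤ ( KL(Q‖Π0) + log(ξ(n)/δ) ) / n holds simultaneously for all posteriors Q ≪ Π0, where ξ(n) := exp(1/(12n)) · √(πn/2) + 2. -/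
open MeasureTheory ProbabilityTheory Real
open scoped ENNReal

/-- The Bernoulli Kullback–Leibler divergence `kl(p‖q)`, with the conventions
`0·log(0/·) = 0` and `kl(p‖q) = +∞` when `(q = 0, p ≠ 0)` or `(q = 1, p ≠ 1)`. -/
noncomputable def klBer (p q : ℝ) : ℝ≥0∞ :=
  if (q = 0 ∧ p ≠ 0) ∨ (q = 1 ∧ p ≠ 1) then ⊤
  else ENNReal.ofReal (p * Real.log (p / q) + (1 - p) * Real.log ((1 - p) / (1 - q)))

open scoped Classical in
/-- The Kullback–Leibler divergence `KL(Q‖Π0)` between measures, `+∞` unless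
`Q ≪ Π0` with integrable log-likelihood ratio. -/
noncomputable def relEnt {Θ : Type*} [MeasurableSpace Θ] (Q Pri : Measure Θ) : ℝ≥0∞ :=
  if Q ≪ Pri ∧ Integrable (llr Q Pri) Q then ENNReal.ofReal (∫ θ, llr Q Pri θ ∂Q) else ⊤

/-- Robbins' upper bound for the Stirling sequence. -/
theorem stirlingSeq_le_sqrt_pi_mul_exp (n : ℕ) :
    Stirling.stirlingSeq (n + 1) ≤ √π * exp (1 / (12 * (n + 1 : ℝ))) := by
  have hmono : Monotone fun k : ℕ =>
      log (Stirling.stirlingSeq (k + 1)) - 1 / (12 * (k + 1 : ℝ)) := by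
    refine monotone_nat_of_le_succ fun k => ?_
    have h := Stirling.log_stirlingSeq_sdiff_le (k + 1)
    have h2 : 1 / (12 * (k + 1 : ℝ)) - 1 / (12 * ((k + 1 : ℕ) + 1 : ℝ))
        = 1 / (12 * (k + 1 : ℕ) * ((k + 1 : ℕ) + 1)) := by
      push_cast
      field_simp
      ring
    linarith
  have hlim : Filter.Tendsto (fun k : ℕ =>
      log (Stirling.stirlingSeq (k + 1)) - 1 / (12 * (k + 1 : ℝ))) Filter.atTop
      (nhds (log √π - 1 / 12 * 0)) := by
    refine Filter.Tendsto.sub ?_ ?_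
    · exact ((Filter.tendsto_add_atTop_iff_nat 1).2
        Stirling.tendsto_stirlingSeq_sqrt_pi).log (by positivity)
    · refine ((tendsto_one_div_add_atTop_nhds_zero_nat (𝕜 := ℝ)).const_mul (1 / 12)).congr
        fun k => ?_
      rw [div_mul_div_comm, one_mul]
  have h := hmono.ge_of_tendsto hlim n
  rw [← Real.log_le_log_iff (Stirling.stirlingSeq'_pos n) (by positivity), log_mul (by positivity) (by positivity),
    log_exp]
  simp only [mul_zero, sub_zero] at h
  linarith

theorem factorial_le_stirling {n : ℕ} (hn : 0 < n) :
    (n.factorial : ℝ) ≤ √(2 * π * n) * (n / exp 1) ^ n * exp (1 / (12 * n)) := by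
  obtain ⟨m, rfl⟩ := Nat.exists_eq_add_of_lt hn
  have h := stirlingSeq_le_sqrt_pi_mul_exp m
  rw [zero_add]
  rw [Stirling.stirlingSeq, div_le_iff₀ (by positivity)] at h
  have hs : √(2 * π * (m + 1 : ℕ)) = √π * √(2 * (m + 1 : ℕ)) := by
    rw [← sqrt_mul pi_pos.le]
    ring_nf
  rw [hs]
  push_cast at h ⊢
  linarith

theorem choose_mul_pow_le {k j : ℕ} (hk : 0 < k) (hj : 0 < j) :
    ((k + j).choose k : ℝ) * ((k : ℝ) / (k + j : ℕ)) ^ k * ((j : ℝ) / (k + j : ℕ)) ^ j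
      ≤ exp (1 / (12 * (k + j : ℕ))) * √((k + j : ℕ) / (2 * π)) * (1 / √((k : ℝ) * j)) := by
  have hn := factorial_le_stirling (n := k + j) (by omega)
  have hk' := Stirling.le_factorial_stirling k
  have hj' := Stirling.le_factorial_stirling j
  have hk0 : (0 : ℝ) < k := by exact_mod_cast hk
  have hj0 : (0 : ℝ) < j := by exact_mod_cast hj
  have hchoose : (k + j).choose k = (k + j).factorial / (k.factorial * j.factorial) := by
    rw [Nat.choose_eq_factorial_div_factorial (Nat.le_add_right k j), Nat.add_sub_cancel_left]
  rw [hchoose, Nat.cast_div (Nat.factorial_mul_factorial_dvd_factorial_add k j) (by positivity)]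
  have hn0 : (0 : ℝ) < (k + j : ℕ) := by positivity
  set n : ℕ := k + j
  have h1 : (n.factorial : ℝ) / ((k.factorial * j.factorial : ℕ) : ℝ) ≤
      (√(2 * π * n) * (n / exp 1) ^ n * exp (1 / (12 * n))) /
        ((√(2 * π * k) * (k / exp 1) ^ k) * (√(2 * π * j) * (j / exp 1) ^ j)) := by
    push_cast
    gcongr
  have hsq : √(2 * π * n) / (√(2 * π * k) * √(2 * π * j))
      = √(n / (2 * π)) * (1 / √((k : ℝ) * j)) := by
    rw [← sqrt_mul (by positivity), ← sqrt_div (by positivity), ← sqrt_one, ← sqrt_div zero_le_one,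
      ← sqrt_mul (by positivity)]
    congr 1
    field_simp
  calc _ ≤ (√(2 * π * n) * (n / exp 1) ^ n * exp (1 / (12 * n))) /
        ((√(2 * π * k) * (k / exp 1) ^ k) * (√(2 * π * j) * (j / exp 1) ^ j))
          * ((k : ℝ) / n) ^ k * ((j : ℝ) / n) ^ j := by gcongr
    _ = exp (1 / (12 * n)) * (√(2 * π * n) / (√(2 * π * k) * √(2 * π * j))) := by
      rw [show ((n : ℝ) / exp 1) ^ n = (n / exp 1) ^ k * (n / exp 1) ^ j from pow_add _ _ _]
      simp only [div_pow]
      field_simp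
    _ = _ := by rw [hsq]; ring

theorem one_div_sqrt_le_arcsin_sub {k n : ℝ} (hk : 1 / 2 ≤ k) (hkn : k + 1 / 2 ≤ n) :
    1 / √(k * (n - k)) ≤
      arcsin (2 * (k + 1 / 2) / n - 1) - arcsin (2 * (k - 1 / 2) / n - 1) := by
  have hn : 0 < n := by linarith
  have hu : sin (arcsin (2 * (k + 1 / 2) / n - 1)) = 2 * (k + 1 / 2) / n - 1 := by
    apply sin_arcsin
    · have : 0 ≤ 2 * (k + 1 / 2) / n := by positivity
      linarith
    · have : 2 * (k + 1 / 2) / n ≤ 2 := by rw [div_le_iff₀ hn]; linarith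
      linarith
  have hv : sin (arcsin (2 * (k - 1 / 2) / n - 1)) = 2 * (k - 1 / 2) / n - 1 := by
    apply sin_arcsin
    · have : 0 ≤ 2 * (k - 1 / 2) / n := div_nonneg (by linarith) hn.le
      linarith
    · have : 2 * (k - 1 / 2) / n ≤ 2 := by rw [div_le_iff₀ hn]; linarith
      linarith
  have hle : arcsin (2 * (k - 1 / 2) / n - 1) ≤ arcsin (2 * (k + 1 / 2) / n - 1) := by
    apply monotone_arcsin
    gcongr
    linarith
  have hu1 := neg_pi_div_two_le_arcsin (2 * (k + 1 / 2) / n - 1)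
  have hu2 := arcsin_le_pi_div_two (2 * (k + 1 / 2) / n - 1)
  have hv1 := neg_pi_div_two_le_arcsin (2 * (k - 1 / 2) / n - 1)
  have hv2 := arcsin_le_pi_div_two (2 * (k - 1 / 2) / n - 1)
  set u := arcsin (2 * (k + 1 / 2) / n - 1)
  set v := arcsin (2 * (k - 1 / 2) / n - 1)
  obtain ⟨s, hs⟩ : ∃ s, s = (u + v) / 2 := ⟨_, rfl⟩
  obtain ⟨d, hd⟩ : ∃ d, d = (u - v) / 2 := ⟨_, rfl⟩
  have hus : u = s + d := by rw [hs, hd]; ring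
  have hvs : v = s - d := by rw [hs, hd]; ring
  rw [hus, sin_add] at hu
  rw [hvs, sin_sub] at hv
  have hA : cos s * sin d = 1 / n := by
    have : 2 * (cos s * sin d) = 2 * (k + 1 / 2) / n - 1 - (2 * (k - 1 / 2) / n - 1) := by
      rw [← hu, ← hv]; ring
    field_simp at this ⊢
    linarith
  have hB : sin s * cos d = 2 * k / n - 1 := by
    have : 2 * (sin s * cos d) = 2 * (k + 1 / 2) / n - 1 + (2 * (k - 1 / 2) / n - 1) := by
      rw [← hu, ← hv]; ring
    field_simp at this ⊢
    linarith
  have hd0 : 0 ≤ d := by rw [hd]; linarith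
  have hcs : 0 ≤ cos s := cos_nonneg_of_neg_pi_div_two_le_of_le (by linarith) (by linarith)
  have hsd : sin d ≤ d := sin_le hd0
  have hkn' : 0 < k * (n - k) := mul_pos (by linarith) (by linarith)
  have hcos : cos s ≤ 2 / n * √(k * (n - k)) := by
    have hc : cos s ^ 2 ≤ (2 / n * √(k * (n - k))) ^ 2 := by
      have e : (2 / n * √(k * (n - k))) ^ 2 = 1 - (2 * k / n - 1) ^ 2 := by
        rw [mul_pow, sq_sqrt hkn'.le]
        field_simp
        ring
      rw [e, ← hB, cos_sq', mul_pow]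
      nlinarith [sq_nonneg (sin s), sq_nonneg (sin d), sin_sq_add_cos_sq d,
        mul_nonneg (sq_nonneg (sin s)) (sq_nonneg (sin d))]
    exact le_of_sq_le_sq hc (by positivity)
  have hsqrt := sqrt_pos.2 hkn'
  rw [hus, hvs, div_le_iff₀ hsqrt]
  have h1 : 1 / n ≤ 2 / n * √(k * (n - k)) * d := by
    rw [← hA]
    calc cos s * sin d ≤ cos s * d := by gcongr
      _ ≤ _ := by gcongr
  have h2 : n * (1 / n) ≤ n * (2 / n * √(k * (n - k)) * d) := by gcongr
  have h3 : n * (2 / n * √(k * (n - k)) * d) = 2 * √(k * (n - k)) * d := by field_simp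
  rw [h3, mul_one_div_cancel hn.ne'] at h2
  linarith

theorem sum_one_div_sqrt_le_pi (m : ℕ) :
    ∑ k ∈ Finset.range m, 1 / √((k + 1 : ℝ) * (m - k)) ≤ π := by
  let A : ℕ → ℝ := fun k => arcsin (2 * ((k : ℝ) + 1 / 2) / (m + 1) - 1)
  calc _ ≤ ∑ k ∈ Finset.range m, (A (k + 1) - A k) := by
        refine Finset.sum_le_sum fun k hk => ?_
        have hkm : (k : ℝ) + 1 ≤ m := by exact_mod_cast Finset.mem_range.1 hk
        have h := one_div_sqrt_le_arcsin_sub (k := (k : ℝ) + 1) (n := (m : ℝ) + 1)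
          (by linarith [(k.cast_nonneg : (0 : ℝ) ≤ k)]) (by linarith)
        have e1 : (m : ℝ) + 1 - (k + 1) = m - k := by ring
        have e2 : (k : ℝ) + 1 - 1 / 2 = k + 1 / 2 := by ring
        rw [e1, e2] at h
        simpa only [A, Nat.cast_add, Nat.cast_one] using h
    _ = A m - A 0 := Finset.sum_range_sub A m
    _ ≤ π := by
      have h1 := arcsin_le_pi_div_two (2 * ((m : ℝ) + 1 / 2) / (m + 1) - 1)
      have h2 := neg_pi_div_two_le_arcsin (2 * (((0 : ℕ) : ℝ) + 1 / 2) / (m + 1) - 1)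
      simp only [A]
      linarith

theorem sum_choose_mul_pow_le {n : ℕ} (hn : 0 < n) :
    ∑ k ∈ Finset.range (n + 1),
      (n.choose k : ℝ) * (((k : ℝ) / n) ^ k * (1 - (k : ℝ) / n) ^ (n - k))
      ≤ exp (1 / (12 * n)) * √(π * n / 2) + 2 := by
  obtain ⟨m, rfl⟩ : ∃ m, n = m + 1 := ⟨n - 1, by omega⟩
  have hm0 : ((m + 1 : ℕ) : ℝ) ≠ 0 := by positivity
  rw [Finset.sum_range_succ, Finset.sum_range_succ']
  have hlast : (((m + 1).choose (m + 1) : ℕ) : ℝ) * ((((m + 1 : ℕ) : ℝ) / (m + 1 : ℕ)) ^ (m + 1) *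
      (1 - ((m + 1 : ℕ) : ℝ) / (m + 1 : ℕ)) ^ (m + 1 - (m + 1))) = 1 := by
    rw [div_self hm0]; simp
  rw [hlast]
  have hsum : ∑ k ∈ Finset.range m, ((m + 1).choose (k + 1) : ℝ) *
      ((((k + 1 : ℕ) : ℝ) / (m + 1 : ℕ)) ^ (k + 1) *
        (1 - ((k + 1 : ℕ) : ℝ) / (m + 1 : ℕ)) ^ (m + 1 - (k + 1)))
      ≤ exp (1 / (12 * (m + 1 : ℕ))) * √((m + 1 : ℕ) / (2 * π)) *
        ∑ k ∈ Finset.range m, 1 / √((k + 1 : ℝ) * (m - k)) := by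
    rw [Finset.mul_sum]
    refine Finset.sum_le_sum fun k hk => ?_
    obtain ⟨j, rfl⟩ := Nat.exists_eq_add_of_lt (Finset.mem_range.1 hk)
    have h := choose_mul_pow_le (k := k + 1) (j := j + 1) (by omega) (by omega)
    have e : k + 1 + (j + 1) = k + j + 1 + 1 := by ring
    rw [e] at h
    have e2 : (1 : ℝ) - ((k + 1 : ℕ) : ℝ) / (k + j + 1 + 1 : ℕ)
        = ((j + 1 : ℕ) : ℝ) / (k + j + 1 + 1 : ℕ) := by
      push_cast
      field_simp
      ring
    have e3 : k + j + 1 + 1 - (k + 1) = j + 1 := by omega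
    have e4 : ((k + j + 1 : ℕ) : ℝ) - k = (j + 1 : ℕ) := by push_cast; ring
    rw [e2, e3, e4, ← mul_assoc]
    simpa using h
  have hpi : √((m + 1 : ℕ) / (2 * π)) * π = √(π * (m + 1 : ℕ) / 2) := by
    nth_rw 2 [← sqrt_sq pi_pos.le]
    rw [← sqrt_mul (by positivity)]
    congr 1
    field_simp
  have hfin : exp (1 / (12 * (m + 1 : ℕ))) * √((m + 1 : ℕ) / (2 * π)) *
        ∑ k ∈ Finset.range m, 1 / √((k + 1 : ℝ) * (m - k))
      ≤ exp (1 / (12 * (m + 1 : ℕ))) * √(π * (m + 1 : ℕ) / 2) := by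
    rw [← hpi, mul_assoc]
    gcongr
    exact sum_one_div_sqrt_le_pi m
  have h0 : ((m + 1).choose 0 : ℝ) * ((((0 : ℕ) : ℝ) / (m + 1 : ℕ)) ^ 0 *
        (1 - ((0 : ℕ) : ℝ) / (m + 1 : ℕ)) ^ (m + 1 - 0)) = 1 := by simp
  rw [h0]
  linarith

/-- The probability that independent Bernoulli variables with means `x i` equal one exactly on
`s`. -/
noncomputable def bernoulliWeight {ι : Type*} [Fintype ι] [DecidableEq ι] (x : ι → ℝ)
    (s : Finset ι) : ℝ :=
  ∏ i, if i ∈ s then x i else 1 - x i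

theorem sum_prod_ite_mem {ι : Type*} [Fintype ι] [DecidableEq ι] (f g : ι → ℝ) :
    ∑ s : Finset ι, ∏ i, (if i ∈ s then f i else g i) = ∏ i, (f i + g i) := by
  rw [Fintype.prod_add]
  refine Finset.sum_congr rfl fun s _ => ?_
  rw [Finset.prod_ite]
  congr 2
  · ext; simp
  · ext; simp

theorem sum_bernoulliWeight {ι : Type*} [Fintype ι] [DecidableEq ι] (x : ι → ℝ) :
    ∑ s, bernoulliWeight x s = 1 := by
  simp [bernoulliWeight, sum_prod_ite_mem]

theorem sum_bernoulliWeight_mul_card {ι : Type*} [Fintype ι] [DecidableEq ι] (x : ι → ℝ) :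
    ∑ s, bernoulliWeight x s * (s.card : ℝ) = ∑ i, x i := by
  have hcard (s : Finset ι) : (s.card : ℝ) = ∑ i, if i ∈ s then (1 : ℝ) else 0 := by simp
  simp_rw [hcard, Finset.mul_sum]
  rw [Finset.sum_comm]
  refine Finset.sum_congr rfl fun i _ => ?_
  have hterm (s : Finset ι) : bernoulliWeight x s * (if i ∈ s then (1 : ℝ) else 0)
      = ∏ j, if j ∈ s then x j else (if j = i then 0 else 1 - x j) := by
    by_cases his : i ∈ s
    · rw [if_pos his, mul_one]
      refine Finset.prod_congr rfl fun j _ => ?_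
      by_cases hj : j ∈ s
      · simp [hj]
      · have : j ≠ i := fun h => hj (h ▸ his)
        simp [hj, this]
    · rw [if_neg his, mul_zero]
      exact (Finset.prod_eq_zero (Finset.mem_univ i) (by simp [his])).symm
  simp_rw [hterm]
  rw [sum_prod_ite_mem, Finset.prod_eq_single i]
  · simp
  · intro j _ hj
    simp [hj]
  · simp

theorem bernoulliWeight_nonneg {ι : Type*} [Fintype ι] [DecidableEq ι] {x : ι → ℝ}
    (hx : ∀ i, x i ∈ Set.Icc (0 : ℝ) 1) (s : Finset ι) : 0 ≤ bernoulliWeight x s := by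
  refine Finset.prod_nonneg fun i _ => ?_
  split_ifs
  · exact (hx i).1
  · exact sub_nonneg.2 (hx i).2

/-- A convex function of an average of `[0,1]`-valued numbers is at most its expectation under
independent Bernoulli variables with the same means. -/
theorem ConvexOn.map_average_le_sum_bernoulliWeight {n : ℕ} (hn : 0 < n) {g : ℝ → ℝ}
    (hg : ConvexOn ℝ (Set.Icc 0 1) g) {x : Fin n → ℝ} (hx : ∀ i, x i ∈ Set.Icc (0 : ℝ) 1) :
    g ((n : ℝ)⁻¹ * ∑ i, x i) ≤ ∑ s, bernoulliWeight x s * g ((s.card : ℝ) / n) := by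
  have hn0 : (0 : ℝ) < n := by exact_mod_cast hn
  have h := hg.map_sum_le (t := Finset.univ) (w := bernoulliWeight x)
    (p := fun s : Finset (Fin n) => (s.card : ℝ) / n) (fun s _ => bernoulliWeight_nonneg hx s)
    (sum_bernoulliWeight x) (fun s _ => ⟨by positivity, by
      rw [div_le_one hn0]
      exact_mod_cast (Finset.card_le_univ s).trans_eq (Fintype.card_fin n)⟩)
  simp only [smul_eq_mul] at h
  have e : (n : ℝ)⁻¹ * ∑ i, x i = ∑ s, bernoulliWeight x s * ((s.card : ℝ) / n) := by
    rw [← sum_bernoulliWeight_mul_card, Finset.mul_sum]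
    refine Finset.sum_congr rfl fun s _ => ?_
    ring
  rwa [e]

theorem integrable_bernoulliWeight {𝒵 : Type*} [MeasurableSpace 𝒵] (μ : Measure 𝒵)
    [IsProbabilityMeasure μ] {n : ℕ} {f : 𝒵 → ℝ} (hf : Integrable f μ) (s : Finset (Fin n)) :
    Integrable (fun ω : Fin n → 𝒵 => bernoulliWeight (fun i => f (ω i)) s)
      (Measure.pi fun _ => μ) := by
  unfold bernoulliWeight
  refine Integrable.fintype_prod (f := fun (i : Fin n) z => if i ∈ s then f z else 1 - f z)
    (μ := fun _ => μ) fun i => ?_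
  split_ifs
  · exact hf
  · exact (integrable_const 1).sub hf

theorem integral_bernoulliWeight {𝒵 : Type*} [MeasurableSpace 𝒵] (μ : Measure 𝒵)
    [IsProbabilityMeasure μ] {n : ℕ} {f : 𝒵 → ℝ} (hf : Integrable f μ) (s : Finset (Fin n)) :
    ∫ ω, bernoulliWeight (fun i => f (ω i)) s ∂(Measure.pi fun _ : Fin n => μ)
      = (∫ z, f z ∂μ) ^ s.card * (1 - ∫ z, f z ∂μ) ^ (n - s.card) := by
  unfold bernoulliWeight
  rw [integral_fintype_prod_eq_prod (fun (i : Fin n) z => if i ∈ s then f z else 1 - f z)]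
  have h (i : Fin n) : ∫ z, (if i ∈ s then f z else 1 - f z) ∂μ
      = if i ∈ s then ∫ z, f z ∂μ else 1 - ∫ z, f z ∂μ := by
    split_ifs
    · rfl
    · rw [integral_sub (integrable_const 1) hf]
      simp
  simp_rw [h]
  rw [Finset.prod_ite, Finset.prod_const, Finset.prod_const]
  congr 2
  · congr 1; ext; simp
  · rw [Finset.filter_not, Finset.card_sdiff_of_subset (Finset.filter_subset _ _)]
    simp

/-- The real-valued formula for the Bernoulli Kullback–Leibler divergence. -/
noncomputable def klBerReal (p q : ℝ) : ℝ :=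
  p * log (p / q) + (1 - p) * log ((1 - p) / (1 - q))

theorem mul_log_div_eq (p : ℝ) {q : ℝ} (hq : q ≠ 0) :
    p * log (p / q) = p * log p - p * log q := by
  rcases eq_or_ne p 0 with rfl | hp
  · simp
  · rw [log_div hp hq]; ring

theorem convexOn_klBerReal {q : ℝ} (hq : q ∈ Set.Ioo (0 : ℝ) 1) :
    ConvexOn ℝ (Set.Icc 0 1) fun p => klBerReal p q := by
  have hq1 : 1 - q ≠ 0 := (sub_pos.2 hq.2).ne'
  simp_rw [klBerReal, mul_log_div_eq _ hq.1.ne', mul_log_div_eq _ hq1]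
  have h1 : ConvexOn ℝ (Set.Icc (0 : ℝ) 1) fun p => p * log p :=
    convexOn_mul_log.subset Set.Icc_subset_Ici_self (convex_Icc _ _)
  refine ⟨convex_Icc _ _, fun x hx y hy a b ha hb hab => ?_⟩
  have hx' : 1 - x ∈ Set.Icc (0 : ℝ) 1 := ⟨by linarith [hx.2], by linarith [hx.1]⟩
  have hy' : 1 - y ∈ Set.Icc (0 : ℝ) 1 := ⟨by linarith [hy.2], by linarith [hy.1]⟩
  have i1 := h1.2 hx hy ha hb hab
  have i2 := h1.2 hx' hy' ha hb hab
  simp only [smul_eq_mul] at i1 i2 ⊢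
  obtain rfl : b = 1 - a := by linarith
  have e : a * (1 - x) + (1 - a) * (1 - y) = 1 - (a * x + (1 - a) * y) := by ring
  rw [e] at i2
  nlinarith

theorem convexOn_exp_mul_klBerReal {q : ℝ} (hq : q ∈ Set.Ioo (0 : ℝ) 1) {c : ℝ} (hc : 0 ≤ c) :
    ConvexOn ℝ (Set.Icc 0 1) fun p => exp (c * klBerReal p q) := by
  refine ⟨convex_Icc _ _, fun x hx y hy a b ha hb hab => ?_⟩
  refine le_trans (exp_le_exp.2 (((convexOn_klBerReal hq).smul hc).2 hx hy ha hb hab)) ?_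
  exact convexOn_exp.2 (Set.mem_univ _) (Set.mem_univ _) ha hb hab

theorem exp_natCast_mul_log {k : ℕ} {y : ℝ} (h : k ≠ 0 → 0 < y) : exp (k * log y) = y ^ k := by
  rcases eq_or_ne k 0 with rfl | hk
  · simp
  · rw [← log_pow, exp_log (pow_pos (h hk) k)]

theorem pow_mul_pow_mul_exp_klBerReal {n k : ℕ} (hn : 0 < n) (hk : k ≤ n) {q : ℝ}
    (hq : q ∈ Set.Ioo (0 : ℝ) 1) :
    q ^ k * (1 - q) ^ (n - k) * exp (n * klBerReal ((k : ℝ) / n) q)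
      = ((k : ℝ) / n) ^ k * (1 - (k : ℝ) / n) ^ (n - k) := by
  have hn0 : (0 : ℝ) < n := by exact_mod_cast hn
  have hq0 := hq.1
  have hq1 : 0 < 1 - q := sub_pos.2 hq.2
  have e1 : (1 : ℝ) - k / n = ((n - k : ℕ) : ℝ) / n := by
    rw [Nat.cast_sub hk]; field_simp
  have e2 : (n : ℝ) * klBerReal ((k : ℝ) / n) q
      = k * log (k / n / q) + (n - k : ℕ) * log ((n - k : ℕ) / n / (1 - q)) := by
    rw [klBerReal, e1]; field_simp
  rw [e2, exp_add, exp_natCast_mul_log, exp_natCast_mul_log, e1, div_pow _ q, div_pow _ (1 - q)]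
  · field_simp
  · intro h
    have : (0 : ℝ) < (n - k : ℕ) := by exact_mod_cast Nat.pos_of_ne_zero h
    positivity
  · intro h
    have : (0 : ℝ) < k := by exact_mod_cast Nat.pos_of_ne_zero h
    positivity

/-- Linear lower bound for `p log (p / q)` by its tangent plane at `(a, b)`. -/
theorem tangent_le_mul_log_div {p q a b : ℝ} (hp : 0 ≤ p) (hq : 0 ≤ q) (hpq : q = 0 → p = 0)
    (ha : 0 < a) (hb : 0 < b) :
    p * (log (a / b) + 1) - q * (a / b) ≤ p * log (p / q) := by
  rcases hp.eq_or_lt with rfl | hp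
  · have : 0 ≤ q * (a / b) := by positivity
    simpa using this
  have hq : 0 < q := hq.lt_of_ne fun h => hp.ne' (hpq h.symm)
  have h := log_le_sub_one_of_pos (x := (a / b) / (p / q)) (by positivity)
  rw [log_div (by positivity) (by positivity)] at h
  have h2 := mul_le_mul_of_nonneg_left h hp.le
  have h3 : p * ((a / b) / (p / q) - 1) = q * (a / b) - p := by field_simp
  linarith

/-- The Donsker–Varadhan variational bound. -/
theorem integral_le_integral_llr_add_log {Θ : Type*} [MeasurableSpace Θ] {Q P : Measure Θ}
    [IsProbabilityMeasure Q] [IsProbabilityMeasure P] (hQP : Q ≪ P)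
    (hInt : Integrable (llr Q P) Q) {f : Θ → ℝ} (hfQ : Integrable f Q)
    (hfP : Integrable (fun θ => exp (f θ)) P) :
    ∫ θ, f θ ∂Q ≤ ∫ θ, llr Q P θ ∂Q + log (∫ θ, exp (f θ) ∂P) := by
  have := isProbabilityMeasure_tilted hfP
  have h := InformationTheory.integral_llr_add_sub_measure_univ_nonneg
    (hQP.trans (absolutelyContinuous_tilted hfP)) (integrable_llr_tilted_right hQP hfQ hInt hfP)
  rw [integral_llr_tilted_right hQP hfQ hfP hInt] at h
  simp only [probReal_univ] at h
  linarith

/-- The exponential of `c` times the Bernoulli Kullback–Leibler divergence, equal to `∞` where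
the divergence is. -/
noncomputable def expKlBer (c p q : ℝ) : ℝ≥0∞ :=
  if (q = 0 ∧ p ≠ 0) ∨ (q = 1 ∧ p ≠ 1) then ⊤ else ENNReal.ofReal (exp (c * klBerReal p q))

theorem measurable_expKlBer (c : ℝ) : Measurable fun r : ℝ × ℝ => expKlBer c r.1 r.2 := by
  unfold expKlBer klBerReal
  refine Measurable.ite ?_ measurable_const (by fun_prop)
  have h1 (a : ℝ) : MeasurableSet {r : ℝ × ℝ | r.1 = a} :=
    measurable_fst (measurableSet_singleton a)
  have h2 (a : ℝ) : MeasurableSet {r : ℝ × ℝ | r.2 = a} :=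
    measurable_snd (measurableSet_singleton a)
  exact ((h2 0).inter (h1 0).compl).union ((h2 1).inter (h1 1).compl)

theorem expKlBer_self_of_eq_zero_or_one (c : ℝ) {q : ℝ} (hq : q = 0 ∨ q = 1) :
    expKlBer c q q = 1 := by
  rcases hq with rfl | rfl <;> simp [expKlBer, klBerReal]

theorem integrable_of_forall_mem_Icc {α : Type*} [MeasurableSpace α] (μ : Measure α)
    [IsProbabilityMeasure μ] {f : α → ℝ} (hf : Measurable f)
    (hf01 : ∀ z, f z ∈ Set.Icc (0 : ℝ) 1) : Integrable f μ :=
  Integrable.of_bound hf.aestronglyMeasurable 1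
    (ae_of_all _ fun z => by rw [norm_of_nonneg (hf01 z).1]; exact (hf01 z).2)

theorem integral_mem_Icc {α : Type*} [MeasurableSpace α] (μ : Measure α)
    [IsProbabilityMeasure μ] {f : α → ℝ} (hf : Integrable f μ)
    (hf01 : ∀ z, f z ∈ Set.Icc (0 : ℝ) 1) : ∫ z, f z ∂μ ∈ Set.Icc (0 : ℝ) 1 := by
  refine ⟨integral_nonneg fun z => (hf01 z).1, ?_⟩
  simpa using integral_mono hf (integrable_const 1) fun z => (hf01 z).2

theorem ae_eq_integral_of_integral_eq_zero_or_one {α : Type*} [MeasurableSpace α] (μ : Measure α)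
    [IsProbabilityMeasure μ] {f : α → ℝ} (hf : Integrable f μ)
    (hf01 : ∀ z, f z ∈ Set.Icc (0 : ℝ) 1) (h : (∫ z, f z ∂μ) = 0 ∨ (∫ z, f z ∂μ) = 1) :
    ∀ᵐ z ∂μ, f z = ∫ z, f z ∂μ := by
  rcases h with h | h
  · rw [h]
    exact (integral_eq_zero_iff_of_nonneg (fun z => (hf01 z).1) hf).1 h
  · have h1 : ∫ z, (1 - f z) ∂μ = 0 := by
      rw [integral_sub (integrable_const 1) hf, h]; simp
    have h2 := (integral_eq_zero_iff_of_nonneg (fun z => sub_nonneg.2 (hf01 z).2)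
      ((integrable_const 1).sub hf)).1 h1
    filter_upwards [h2] with z hz
    rw [h]
    exact (sub_eq_zero.1 hz).symm

theorem lintegral_expKlBer_average_le {𝒵 : Type*} [MeasurableSpace 𝒵] (μ : Measure 𝒵)
    [IsProbabilityMeasure μ] {n : ℕ} (hn : 0 < n) {f : 𝒵 → ℝ} (hf : Measurable f)
    (hf01 : ∀ z, f z ∈ Set.Icc (0 : ℝ) 1) :
    ∫⁻ ω, expKlBer n ((n : ℝ)⁻¹ * ∑ i, f (ω i)) (∫ z, f z ∂μ) ∂(Measure.pi fun _ : Fin n => μ)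
      ≤ ENNReal.ofReal (exp (1 / (12 * n)) * √(π * n / 2) + 2) := by
  have hn0 : (0 : ℝ) < n := by exact_mod_cast hn
  have hfi : Integrable f μ := integrable_of_forall_mem_Icc μ hf hf01
  have hmem := integral_mem_Icc μ hfi hf01
  by_cases hq : (∫ z, f z ∂μ) = 0 ∨ (∫ z, f z ∂μ) = 1
  · have hae := ae_eq_integral_of_integral_eq_zero_or_one μ hfi hf01 hq
    have hall : ∀ᵐ ω ∂(Measure.pi fun _ : Fin n => μ), ∀ i, f (ω i) = ∫ z, f z ∂μ :=
      Filter.eventually_all.2 fun i =>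
        (Measure.tendsto_eval_ae_ae (μ := fun _ : Fin n => μ) (i := i)).eventually hae
    have hone : ∀ᵐ ω ∂(Measure.pi fun _ : Fin n => μ),
        expKlBer n ((n : ℝ)⁻¹ * ∑ i, f (ω i)) (∫ z, f z ∂μ) = 1 := by
      filter_upwards [hall] with ω hω
      simp_rw [hω]
      rw [Finset.sum_const, Finset.card_univ, Fintype.card_fin, nsmul_eq_mul,
        inv_mul_cancel_left₀ hn0.ne']
      exact expKlBer_self_of_eq_zero_or_one _ hq
    rw [lintegral_congr_ae hone]
    simp only [lintegral_one, measure_univ]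
    rw [← ENNReal.ofReal_one]
    apply ENNReal.ofReal_le_ofReal
    have : 0 ≤ exp (1 / (12 * n)) * √(π * n / 2) := by positivity
    linarith
  · push Not at hq
    have hq01 : (∫ z, f z ∂μ) ∈ Set.Ioo (0 : ℝ) 1 :=
      ⟨lt_of_le_of_ne hmem.1 hq.1.symm, lt_of_le_of_ne hmem.2 hq.2⟩
    set q := ∫ z, f z ∂μ
    let g : ℝ → ℝ := fun p => exp (n * klBerReal p q)
    have hg : ConvexOn ℝ (Set.Icc 0 1) g := convexOn_exp_mul_klBerReal hq01 hn0.le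
    have hInt (s : Finset (Fin n)) : Integrable (fun ω : Fin n → 𝒵 =>
        bernoulliWeight (fun i => f (ω i)) s * g ((s.card : ℝ) / n)) (Measure.pi fun _ => μ) :=
      (integrable_bernoulliWeight μ hfi s).mul_const _
    calc _ ≤ ∫⁻ ω, ENNReal.ofReal
          (∑ s, bernoulliWeight (fun i => f (ω i)) s * g ((s.card : ℝ) / n))
          ∂(Measure.pi fun _ : Fin n => μ) := by
          refine lintegral_mono fun ω => ?_
          rw [expKlBer, if_neg (by simp [hq])]
          exact ENNReal.ofReal_le_ofReal
            (hg.map_average_le_sum_bernoulliWeight hn fun i => hf01 (ω i))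
      _ = ENNReal.ofReal (∫ ω, ∑ s, bernoulliWeight (fun i => f (ω i)) s * g ((s.card : ℝ) / n)
          ∂(Measure.pi fun _ : Fin n => μ)) := by
          rw [ofReal_integral_eq_lintegral_ofReal (integrable_finsetSum _ fun s _ => hInt s)]
          exact ae_of_all _ fun ω => Finset.sum_nonneg fun s _ =>
            mul_nonneg (bernoulliWeight_nonneg (fun i => hf01 (ω i)) s) (exp_pos _).le
      _ ≤ _ := by
          apply ENNReal.ofReal_le_ofReal
          refine le_trans (le_of_eq ?_) (sum_choose_mul_pow_le hn)
          rw [integral_finsetSum _ fun s _ => hInt s]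
          have hterm (s : Finset (Fin n)) : ∫ ω, bernoulliWeight (fun i => f (ω i)) s *
              g ((s.card : ℝ) / n) ∂(Measure.pi fun _ : Fin n => μ) =
              ((s.card : ℝ) / n) ^ s.card * (1 - (s.card : ℝ) / n) ^ (n - s.card) := by
            rw [integral_mul_const, integral_bernoulliWeight μ hfi]
            exact pow_mul_pow_mul_exp_klBerReal hn
              ((Finset.card_le_univ s).trans_eq (Fintype.card_fin n)) hq01
          simp_rw [hterm]
          have h := Finset.sum_powerset_apply_card
            (fun k => ((k : ℝ) / n) ^ k * (1 - (k : ℝ) / n) ^ (n - k))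
            (x := (Finset.univ : Finset (Fin n)))
          simpa using h

theorem klBerReal_le_of_forall_mem_Ioo {a b C : ℝ} (ha : a ∈ Set.Icc (0 : ℝ) 1)
    (hb : b ∈ Set.Ioo (0 : ℝ) 1)
    (h : ∀ t ∈ Set.Ioo (0 : ℝ) 1, a * log (t / b) + (1 - a) * log ((1 - t) / (1 - b)) ≤ C) :
    klBerReal a b ≤ C := by
  have hb1 : 0 < 1 - b := sub_pos.2 hb.2
  have hb0 := hb.1
  have key : ∀ d : ℝ, 0 < d → (∀ t ∈ Set.Ioo (0 : ℝ) 1, log (t / d) ≤ C) → log (1 / d) ≤ C := by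
    intro d hd hlog
    rw [log_le_iff_le_exp (by positivity), div_le_iff₀ hd]
    refine le_of_forall_lt_imp_le_of_dense fun t ht => ?_
    rcases le_or_gt t 0 with h0 | h0
    · exact h0.trans (by positivity)
    · have := hlog t ⟨h0, ht⟩
      rwa [log_le_iff_le_exp (by positivity), div_le_iff₀ hd] at this
  rcases ha.1.eq_or_lt with rfl | ha0
  · have := key (1 - b) hb1 fun t ht => by
      simpa using h (1 - t) ⟨sub_pos.2 ht.2, by linarith [ht.1]⟩
    simpa [klBerReal] using this
  rcases ha.2.eq_or_lt with rfl | ha1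
  · have := key b hb0 fun t ht => by simpa using h t ht
    simpa [klBerReal] using this
  exact h a ⟨ha0, ha1⟩

/-- The affine minorant of the Bernoulli Kullback–Leibler divergence that touches it at
`(t, b)`. -/
noncomputable def klBerTangent (t b p q : ℝ) : ℝ :=
  p * (log (t / b) + 1) - q * (t / b) +
    ((1 - p) * (log ((1 - t) / (1 - b)) + 1) - (1 - q) * ((1 - t) / (1 - b)))

theorem ofReal_exp_klBerTangent_le {c t b p q : ℝ} (hc : 0 ≤ c) (ht : t ∈ Set.Ioo (0 : ℝ) 1)
    (hb : b ∈ Set.Ioo (0 : ℝ) 1) (hp : p ∈ Set.Icc (0 : ℝ) 1) (hq : q ∈ Set.Icc (0 : ℝ) 1) :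
    ENNReal.ofReal (exp (c * klBerTangent t b p q)) ≤ expKlBer c p q := by
  unfold expKlBer
  split_ifs with h
  · exact le_top
  push Not at h
  apply ENNReal.ofReal_le_ofReal
  gcongr
  refine add_le_add (tangent_le_mul_log_div hp.1 hq.1 h.1 ht.1 hb.1)
    (tangent_le_mul_log_div (sub_nonneg.2 hp.2) (sub_nonneg.2 hq.2) (fun h1 => ?_)
      (sub_pos.2 ht.2) (sub_pos.2 hb.2))
  rw [h.2 (by linarith), sub_self]

theorem integral_klBerTangent {Θ : Type*} [MeasurableSpace Θ] (Q : Measure Θ)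
    [IsProbabilityMeasure Q] {M L : Θ → ℝ} (hM : Integrable M Q) (hL : Integrable L Q) (t b : ℝ) :
    ∫ θ, klBerTangent t b (M θ) (L θ) ∂Q = klBerTangent t b (∫ θ, M θ ∂Q) (∫ θ, L θ ∂Q) := by
  have e (p q : ℝ) : klBerTangent t b p q =
      p * (log (t / b) - log ((1 - t) / (1 - b))) + q * ((1 - t) / (1 - b) - t / b) +
        (log ((1 - t) / (1 - b)) + 1 - (1 - t) / (1 - b)) := by
    unfold klBerTangent; ring
  simp_rw [e]
  rw [integral_add (by fun_prop) (integrable_const _),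
    integral_add (hM.mul_const _) (hL.mul_const _), integral_mul_const, integral_mul_const]
  simp

theorem klBerTangent_same {t b : ℝ} (hb : b ∈ Set.Ioo (0 : ℝ) 1) (p : ℝ) :
    klBerTangent t b p b = p * log (t / b) + (1 - p) * log ((1 - t) / (1 - b)) := by
  have hb1 : 1 - b ≠ 0 := (sub_pos.2 hb.2).ne'
  have hb0 : b ≠ 0 := hb.1.ne'
  unfold klBerTangent
  field_simp
  ring

theorem klBer_self_of_eq_zero_or_one {q : ℝ} (hq : q = 0 ∨ q = 1) : klBer q q = 0 := by
  rcases hq with rfl | rfl <;> simp [klBer]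

/-- The change-of-measure bound: an exponential moment of the Bernoulli divergence under the prior
controls the divergence of the averages under every posterior. -/
theorem klBer_integral_le_of_lintegral_expKlBer_le {Θ : Type*} [MeasurableSpace Θ]
    (P Q : Measure Θ) [IsProbabilityMeasure P] [IsProbabilityMeasure Q] (hQP : Q ≪ P)
    {n : ℕ} (hn : 0 < n) {M L : Θ → ℝ} (hM : Measurable M) (hL : Measurable L)
    (hM01 : ∀ θ, M θ ∈ Set.Icc (0 : ℝ) 1) (hL01 : ∀ θ, L θ ∈ Set.Icc (0 : ℝ) 1)
    {B : ℝ} (hB : 0 < B)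
    (h : ∫⁻ θ, expKlBer n (M θ) (L θ) ∂P ≤ ENNReal.ofReal B) :
    klBer (∫ θ, M θ ∂Q) (∫ θ, L θ ∂Q) ≤ (relEnt Q P + ENNReal.ofReal (log B)) / n := by
  have hn0 : (0 : ℝ) < n := by exact_mod_cast hn
  have hMi : Integrable M Q := integrable_of_forall_mem_Icc Q hM hM01
  have hLi : Integrable L Q := integrable_of_forall_mem_Icc Q hL hL01
  have hMQ := integral_mem_Icc Q hMi hM01
  have hLQ := integral_mem_Icc Q hLi hL01
  by_cases hq : (∫ θ, L θ ∂Q) = 0 ∨ (∫ θ, L θ ∂Q) = 1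
  · have hfin : ∀ᵐ θ ∂Q, expKlBer n (M θ) (L θ) < ⊤ :=
      hQP.ae_le (ae_lt_top ((measurable_expKlBer n).comp (hM.prodMk hL))
        (h.trans_lt ENNReal.ofReal_lt_top).ne)
    have hLae := ae_eq_integral_of_integral_eq_zero_or_one Q hLi hL01 hq
    have hMae : ∀ᵐ θ ∂Q, M θ = ∫ θ, L θ ∂Q := by
      filter_upwards [hfin, hLae] with θ h1 h2
      by_contra hne
      refine h1.ne (if_pos ?_)
      rw [h2]
      exact hq.imp (fun h => ⟨h, h ▸ hne⟩) (fun h => ⟨h, h ▸ hne⟩)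
    have e : ∫ θ, M θ ∂Q = ∫ θ, L θ ∂Q := by
      rw [integral_congr_ae hMae]; simp
    rw [e, klBer_self_of_eq_zero_or_one hq]
    exact zero_le
  push Not at hq
  have hb : (∫ θ, L θ ∂Q) ∈ Set.Ioo (0 : ℝ) 1 :=
    ⟨lt_of_le_of_ne hLQ.1 hq.1.symm, lt_of_le_of_ne hLQ.2 hq.2⟩
  unfold relEnt
  split_ifs with hrel
  swap
  · rw [top_add, ENNReal.top_div_of_ne_top (ENNReal.natCast_ne_top n)]
    exact le_top
  rw [klBer, if_neg (by simp [hq]), ENNReal.le_div_iff_mul_le (by simp [hn.ne']) (by simp),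
    ← ENNReal.ofReal_natCast, ← ENNReal.ofReal_mul' hn0.le]
  refine le_trans (ENNReal.ofReal_le_ofReal ?_) ENNReal.ofReal_add_le
  rw [← le_div_iff₀ hn0]
  refine klBerReal_le_of_forall_mem_Ioo hMQ hb fun t ht => ?_
  set b := ∫ θ, L θ ∂Q with hbdef
  rw [← klBerTangent_same hb, hbdef, ← integral_klBerTangent Q hMi hLi, le_div_iff₀ hn0, mul_comm,
    ← integral_const_mul, ← hbdef]
  have hTm : Measurable fun θ => klBerTangent t b (M θ) (L θ) := by
    unfold klBerTangent
    fun_prop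
  have hle : ∫⁻ θ, ENNReal.ofReal (exp (n * klBerTangent t b (M θ) (L θ))) ∂P
      ≤ ENNReal.ofReal B :=
    (lintegral_mono fun θ => ofReal_exp_klBerTangent_le hn0.le ht hb (hM01 θ) (hL01 θ)).trans h
  have hexp : Integrable (fun θ => exp (n * klBerTangent t b (M θ) (L θ))) P := by
    refine ⟨(hTm.const_mul _).exp.aestronglyMeasurable, ?_⟩
    rw [hasFiniteIntegral_iff_ofReal (ae_of_all _ fun θ => (exp_pos _).le)]
    exact hle.trans_lt ENNReal.ofReal_lt_top
  have hTi : Integrable (fun θ => klBerTangent t b (M θ) (L θ)) Q := by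
    unfold klBerTangent
    exact ((hMi.mul_const _).sub (hLi.mul_const _)).add
      ((((integrable_const 1).sub hMi).mul_const _).sub
        (((integrable_const 1).sub hLi).mul_const _))
  refine (integral_le_integral_llr_add_log hQP hrel.2 (hTi.const_mul _) hexp).trans ?_
  gcongr
  · exact integral_exp_pos hexp
  · rw [integral_eq_lintegral_of_nonneg_ae (ae_of_all _ fun θ => (exp_pos _).le)
      hexp.aestronglyMeasurable]
    exact ENNReal.toReal_le_of_le_ofReal hB.le hle

/-- **Uniform Seeger–Langford inequality for bounded losses.** -/
theorem uniform_seeger_langford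
    {Θ 𝒵 : Type*} [MeasurableSpace Θ] [MeasurableSpace 𝒵]
    -- prior on the parameter space, independent of the sample
    (Pri : Measure Θ) [IsProbabilityMeasure Pri]
    -- distribution of one observation; the sample is i.i.d. from it
    (μZ : Measure 𝒵) [IsProbabilityMeasure μZ]
    (n : ℕ) (hn : 0 < n)
    -- measurable loss with values in [0,1]
    (ℓ : Θ → 𝒵 → ℝ) (hℓ : Measurable fun q : Θ × 𝒵 => ℓ q.1 q.2)
    (hℓ01 : ∀ θ z, ℓ θ z ∈ Set.Icc (0 : ℝ) 1)
    (δ : ℝ) (hδ : δ ∈ Set.Ioo (0 : ℝ) 1) :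
    ENNReal.ofReal (1 - δ) ≤
      (Measure.pi fun _ : Fin n => μZ)
        {ωs | ∀ Q : Measure Θ, IsProbabilityMeasure Q → Q ≪ Pri →
          klBer (∫ θ, (n : ℝ)⁻¹ * ∑ i, ℓ θ (ωs i) ∂Q)
              (∫ θ, (∫ z, ℓ θ z ∂μZ) ∂Q)
            ≤ (relEnt Q Pri
                + ENNReal.ofReal (Real.log
                    ((Real.exp (1 / (12 * n)) * Real.sqrt (π * n / 2) + 2) / δ))) / n} := by
  have hn0 : (0 : ℝ) < n := by exact_mod_cast hn
  obtain ⟨hδ0, hδ1⟩ := hδ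
  set ξ : ℝ := exp (1 / (12 * n)) * √(π * n / 2) + 2
  have hξ0 : 0 < ξ := by positivity
  have hB : 0 < ξ / δ := div_pos hξ0 hδ0
  let μ : Measure (Fin n → 𝒵) := Measure.pi fun _ => μZ
  let M : Θ → (Fin n → 𝒵) → ℝ := fun θ ω => (n : ℝ)⁻¹ * ∑ i, ℓ θ (ω i)
  let L : Θ → ℝ := fun θ => ∫ z, ℓ θ z ∂μZ
  have hL : Measurable L :=
    (hℓ.stronglyMeasurable.integral_prod_right' (ν := μZ)).measurable
  have hℓθ (θ : Θ) : Measurable (ℓ θ) := hℓ.comp measurable_prodMk_left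
  have hM : Measurable fun r : Θ × (Fin n → 𝒵) => M r.1 r.2 := by
    refine (Finset.measurable_sum _ fun i _ => ?_).const_mul _
    exact hℓ.comp (measurable_fst.prodMk ((measurable_pi_apply i).comp measurable_snd))
  have hM01 (θ : Θ) (ω : Fin n → 𝒵) : M θ ω ∈ Set.Icc (0 : ℝ) 1 := by
    refine ⟨mul_nonneg (by positivity) (Finset.sum_nonneg fun i _ => (hℓ01 θ (ω i)).1), ?_⟩
    rw [inv_mul_le_one₀ hn0]
    simpa using Finset.sum_le_sum fun i (_ : i ∈ Finset.univ) => (hℓ01 θ (ω i)).2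
  have hL01 (θ : Θ) : L θ ∈ Set.Icc (0 : ℝ) 1 :=
    integral_mem_Icc μZ (integrable_of_forall_mem_Icc μZ (hℓθ θ) (hℓ01 θ)) (hℓ01 θ)
  have hF : Measurable fun r : Θ × (Fin n → 𝒵) => expKlBer n (M r.1 r.2) (L r.1) :=
    (measurable_expKlBer n).comp (hM.prodMk (hL.comp measurable_fst))
  let G : (Fin n → 𝒵) → ℝ≥0∞ := fun ω => ∫⁻ θ, expKlBer n (M θ ω) (L θ) ∂Pri
  have hG : Measurable G := hF.lintegral_prod_left'
  have hGint : ∫⁻ ω, G ω ∂μ ≤ ENNReal.ofReal ξ := by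
    rw [← lintegral_lintegral_swap (f := fun θ ω => expKlBer n (M θ ω) (L θ)) hF.aemeasurable]
    calc _ ≤ ∫⁻ _ : Θ, ENNReal.ofReal ξ ∂Pri :=
          lintegral_mono fun θ => lintegral_expKlBer_average_le μZ hn (hℓθ θ) (hℓ01 θ)
      _ = _ := by simp
  have hmarkov : μ {ω | ENNReal.ofReal (ξ / δ) ≤ G ω} ≤ ENNReal.ofReal δ := by
    refine (meas_ge_le_lintegral_div hG.aemeasurable (by simpa using hB)
      ENNReal.ofReal_ne_top).trans ?_
    refine (ENNReal.div_le_div_right hGint _).trans_eq ?_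
    rw [← ENNReal.ofReal_div_of_pos hB, div_div_cancel₀ hξ0.ne']
  have hgood : ENNReal.ofReal (1 - δ) ≤ μ {ω | ENNReal.ofReal (ξ / δ) ≤ G ω}ᶜ := by
    rw [prob_compl_eq_one_sub (measurableSet_le measurable_const hG),
      ENNReal.ofReal_sub _ hδ0.le, ENNReal.ofReal_one]
    exact tsub_le_tsub_left hmarkov 1
  refine hgood.trans (measure_mono fun ω hω Q hQ hQP => ?_)
  rw [Set.mem_compl_iff, Set.mem_ofPred_eq, not_le] at hω
  exact klBer_integral_le_of_lintegral_expKlBer_le Pri Q hQP hn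
    (hM.comp measurable_prodMk_right) hL (fun θ => hM01 θ ω) hL01 hB hω.le
end
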